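/- arXiv:2210.02562 — 6 statements merged into one kernel-verified Lean document; each statement's English description precedes it below -/
import Mathlib

section
/- Let g ∈ ℝ^d be a fixed vector and let u be a random vector distributed uniformly on the unit sphere S^{d−1} ⊂ ℝ^d. Then (1/(20√d))·‖g‖ ≤ E[|⟨g, u⟩|] ≤ (1/√d)·‖g‖. -/
open MeasureTheory
open scoped RealInnerProductSpace

/-- A continuous function is integrable for a finite measure carried by the unit sphere. -/
lemma Continuous.integrable_of_ae_norm_eq_one {d : ℕ}
    {μ : Measure (EuclideanSpace ℝ (Fin d))} [IsFiniteMeasure μ]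
    (hsph : ∀ᵐ x ∂μ, ‖x‖ = 1) {f : EuclideanSpace ℝ (Fin d) → ℝ} (hf : Continuous f) :
    Integrable f μ := by
  obtain ⟨C, hC⟩ := (isCompact_sphere (0 : EuclideanSpace ℝ (Fin d)) 1).exists_bound_of_continuousOn
    hf.continuousOn
  refine Integrable.of_bound hf.aestronglyMeasurable C ?_
  filter_upwards [hsph] with x hx
  exact hC x (by simpa using hx)

/-- For a rotation-invariant measure, the law of `⟪v, ·⟫` depends only on `‖v‖`. -/
lemma integral_comp_inner_eq_of_norm_eq {d : ℕ}
    {μ : Measure (EuclideanSpace ℝ (Fin d))}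
    (hrot : ∀ T : EuclideanSpace ℝ (Fin d) ≃ₗᵢ[ℝ] EuclideanSpace ℝ (Fin d),
      Measure.map (⇑T) μ = μ)
    (f : ℝ → ℝ) {v w : EuclideanSpace ℝ (Fin d)} (h : ‖v‖ = ‖w‖) :
    ∫ x, f ⟪v, x⟫ ∂μ = ∫ x, f ⟪w, x⟫ ∂μ := by
  let T := (ℝ ∙ (v - w))ᗮ.reflection
  have hT : T v = w := Submodule.reflection_sub h
  calc ∫ x, f ⟪v, x⟫ ∂μ = ∫ x, f ⟪w, T x⟫ ∂μ := by
        simp only [← hT, LinearIsometryEquiv.inner_map_map]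
    _ = ∫ x, f ⟪w, x⟫ ∂(Measure.map (⇑T) μ) :=
        (T.toHomeomorph.measurableEmbedding.integral_map fun x => f ⟪w, x⟫).symm
    _ = ∫ x, f ⟪w, x⟫ ∂μ := by rw [hrot T]

section Moments

variable {d : ℕ} {μ : Measure (EuclideanSpace ℝ (Fin d))}

lemma integral_comp_coord_eq
    (hrot : ∀ T : EuclideanSpace ℝ (Fin d) ≃ₗᵢ[ℝ] EuclideanSpace ℝ (Fin d),
      Measure.map (⇑T) μ = μ) (f : ℝ → ℝ) (i j : Fin d) :
    ∫ x, f (x i) ∂μ = ∫ x, f (x j) ∂μ := by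
  have h := integral_comp_inner_eq_of_norm_eq hrot f
    (v := EuclideanSpace.single i (1 : ℝ)) (w := EuclideanSpace.single j (1 : ℝ)) (by simp)
  simpa [EuclideanSpace.inner_single_left] using h

lemma integral_coord_sq [IsProbabilityMeasure μ] (hsph : ∀ᵐ x ∂μ, ‖x‖ = 1)
    (hrot : ∀ T : EuclideanSpace ℝ (Fin d) ≃ₗᵢ[ℝ] EuclideanSpace ℝ (Fin d),
      Measure.map (⇑T) μ = μ) (i : Fin d) :
    d * ∫ x, (x i) ^ 2 ∂μ = 1 := by
  have hsum : ∫ x, ∑ j, (x j) ^ 2 ∂μ = 1 := by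
    rw [integral_congr_ae (g := fun _ => (1 : ℝ))]
    · simp
    · filter_upwards [hsph] with x hx
      rw [← EuclideanSpace.real_norm_sq_eq, hx, one_pow]
  rw [integral_finsetSum _ fun j _ => Continuous.integrable_of_ae_norm_eq_one hsph (by fun_prop),
    Finset.sum_congr rfl fun j _ => integral_comp_coord_eq hrot (fun t => t ^ 2) j i] at hsum
  simpa using hsum

lemma integral_coord_sq_mul_sq [IsProbabilityMeasure μ] (hsph : ∀ᵐ x ∂μ, ‖x‖ = 1)
    (hrot : ∀ T : EuclideanSpace ℝ (Fin d) ≃ₗᵢ[ℝ] EuclideanSpace ℝ (Fin d),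
      Measure.map (⇑T) μ = μ) {i j : Fin d} (hij : i ≠ j) :
    3 * ∫ x, (x i) ^ 2 * (x j) ^ 2 ∂μ = ∫ x, (x i) ^ 4 ∂μ := by
  have hnorm (ε : ℝ) (hε : ε ^ 2 = 1) :
      ‖EuclideanSpace.single i (1 : ℝ) + EuclideanSpace.single j ε‖
        = ‖EuclideanSpace.single i (√2)‖ := by
    rw [← sq_eq_sq₀ (norm_nonneg _) (norm_nonneg _), norm_add_sq_real]
    simp [EuclideanSpace.inner_single_left, hij, hε]
    norm_num
  have hs : (√2 : ℝ) ^ 4 = 4 := by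
    rw [show (√2 : ℝ) ^ 4 = (√2 ^ 2) ^ 2 by ring, Real.sq_sqrt (by norm_num)]; norm_num
  have key (ε : ℝ) (hε : ε ^ 2 = 1) :
      ∫ x, (x i + ε * x j) ^ 4 ∂μ = 4 * ∫ x, (x i) ^ 4 ∂μ := by
    have h := integral_comp_inner_eq_of_norm_eq hrot (fun t => t ^ 4) (hnorm ε hε)
    simpa [inner_add_left, EuclideanSpace.inner_single_left, mul_pow, hs,
      integral_const_mul] using h
  have hint {f : EuclideanSpace ℝ (Fin d) → ℝ} (hf : Continuous f) : Integrable f μ :=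
    hf.integrable_of_ae_norm_eq_one hsph
  have hexp : ∫ x, ((x i + 1 * x j) ^ 4 + (x i + -1 * x j) ^ 4) ∂μ
      = ∫ x, (2 * (x i) ^ 4 + 12 * ((x i) ^ 2 * (x j) ^ 2) + 2 * (x j) ^ 4) ∂μ := by
    congr 1; ext x; ring
  rw [integral_add (hint (by fun_prop)) (hint (by fun_prop)), key 1 (by norm_num),
    key (-1) (by norm_num), integral_add (hint (by fun_prop)) (hint (by fun_prop)),
    integral_add (hint (by fun_prop)) (hint (by fun_prop)), integral_const_mul,
    integral_const_mul, integral_const_mul,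
    integral_comp_coord_eq hrot (fun t => t ^ 4) j i] at hexp
  linarith

lemma integral_coord_pow_four_le [IsProbabilityMeasure μ] (hsph : ∀ᵐ x ∂μ, ‖x‖ = 1)
    (hrot : ∀ T : EuclideanSpace ℝ (Fin d) ≃ₗᵢ[ℝ] EuclideanSpace ℝ (Fin d),
      Measure.map (⇑T) μ = μ) (i : Fin d) :
    (d : ℝ) ^ 2 * ∫ x, (x i) ^ 4 ∂μ ≤ 3 := by
  have hint {f : EuclideanSpace ℝ (Fin d) → ℝ} (hf : Continuous f) : Integrable f μ :=
    hf.integrable_of_ae_norm_eq_one hsph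
  have hsum : ∫ x, ∑ j, ∑ k, (x j) ^ 2 * (x k) ^ 2 ∂μ = 1 := by
    rw [integral_congr_ae (g := fun _ => (1 : ℝ))]
    · simp
    · filter_upwards [hsph] with x hx
      rw [← Finset.sum_mul_sum, ← EuclideanSpace.real_norm_sq_eq, hx]
      norm_num
  have hterm (j k : Fin d) :
      (∫ x, (x i) ^ 4 ∂μ) / 3 ≤ ∫ x, (x j) ^ 2 * (x k) ^ 2 ∂μ := by
    rw [integral_comp_coord_eq hrot (fun t => t ^ 4) i j]
    rcases eq_or_ne j k with rfl | hjk
    · have h0 : 0 ≤ ∫ x, (x j) ^ 4 ∂μ := integral_nonneg fun x => by positivity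
      simp only [← pow_add]
      linarith
    · linarith [integral_coord_sq_mul_sq hsph hrot hjk]
  have hle : ∑ _j : Fin d, ∑ _k : Fin d, (∫ x, (x i) ^ 4 ∂μ) / 3 ≤ 1 := by
    rw [← hsum, integral_finsetSum _ fun j _ => hint (by fun_prop)]
    refine Finset.sum_le_sum fun j _ => ?_
    rw [integral_finsetSum _ fun k _ => hint (by fun_prop)]
    exact Finset.sum_le_sum fun k _ => hterm j k
  simp only [Finset.sum_const, Finset.card_univ, Fintype.card_fin, nsmul_eq_mul] at hle
  linarith

end Moments

lemma sq_sub_pow_four_div_four_le_abs (s : ℝ) : s ^ 2 - s ^ 4 / 4 ≤ |s| := by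
  have h2 : s ^ 2 = |s| ^ 2 := (sq_abs s).symm
  have h4 : s ^ 4 = |s| ^ 4 := by rw [show s ^ 4 = (s ^ 2) ^ 2 by ring, h2]; ring
  rw [h2, h4]
  have hs := abs_nonneg s
  generalize |s| = t at hs
  have hq : 0 ≤ 1 - t + t ^ 3 / 4 := by
    nlinarith [mul_nonneg hs (sq_nonneg (t - 1)), sq_nonneg (t - 1), sq_nonneg (t - 3 / 2),
      mul_nonneg hs (sq_nonneg (t - 6 / 5))]
  nlinarith [mul_nonneg hs hq]

/-- For a fixed vector `g ∈ ℝ^d` and `u` uniform (i.e. distributed according to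
the rotation-invariant probability measure) on the unit sphere `S^{d-1}`,
`(1/(20√d))·‖g‖ ≤ E[|⟨g, u⟩|] ≤ (1/√d)·‖g‖`. -/
theorem stmt1 (d : ℕ) (hd : 0 < d) (g : EuclideanSpace ℝ (Fin d))
    (μ : Measure (EuclideanSpace ℝ (Fin d))) [IsProbabilityMeasure μ]
    (hsph : ∀ᵐ x ∂μ, ‖x‖ = 1)
    (hrot : ∀ T : EuclideanSpace ℝ (Fin d) ≃ₗᵢ[ℝ] EuclideanSpace ℝ (Fin d),
      Measure.map (⇑T) μ = μ) :
    (1 / (20 * Real.sqrt d)) * ‖g‖ ≤ ∫ x, |⟪g, x⟫| ∂μ ∧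
      ∫ x, |⟪g, x⟫| ∂μ ≤ (1 / Real.sqrt d) * ‖g‖ := by
  have hint {f : EuclideanSpace ℝ (Fin d) → ℝ} (hf : Continuous f) : Integrable f μ :=
    hf.integrable_of_ae_norm_eq_one hsph
  let i : Fin d := ⟨0, hd⟩
  have hg : ∫ x, |⟪g, x⟫| ∂μ = ‖g‖ * ∫ x, |x i| ∂μ := by
    have h := integral_comp_inner_eq_of_norm_eq hrot (fun t => |t|)
      (v := g) (w := EuclideanSpace.single i ‖g‖) (by simp)
    simpa [EuclideanSpace.inner_single_left, abs_mul, integral_const_mul] using h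
  have hr : 0 < √(d : ℝ) := Real.sqrt_pos.2 (by exact_mod_cast hd)
  have hr2 : √(d : ℝ) ^ 2 = d := Real.sq_sqrt (Nat.cast_nonneg d)
  have hr4 : √(d : ℝ) ^ 4 = (d : ℝ) ^ 2 := by
    rw [show √(d : ℝ) ^ 4 = (√(d : ℝ) ^ 2) ^ 2 by ring, hr2]
  have h2 := integral_coord_sq hsph hrot i
  have h4 := integral_coord_pow_four_le hsph hrot i
  have habs (x : EuclideanSpace ℝ (Fin d)) : |√(d : ℝ) * x i| = √(d : ℝ) * |x i| := by
    rw [abs_mul, abs_of_pos hr]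
  have lower : 1 / 4 ≤ √(d : ℝ) * ∫ x, |x i| ∂μ := by
    have h : ∫ x, ((d : ℝ) * (x i) ^ 2 - (d : ℝ) ^ 2 / 4 * (x i) ^ 4) ∂μ
        ≤ ∫ x, √(d : ℝ) * |x i| ∂μ := by
      refine integral_mono (hint (by fun_prop)) (hint (by fun_prop)) fun x => ?_
      have h := sq_sub_pow_four_div_four_le_abs (√(d : ℝ) * x i)
      rw [habs, mul_pow, mul_pow, hr2, hr4] at h
      dsimp only
      linarith
    rw [integral_sub (hint (by fun_prop)) (hint (by fun_prop)), integral_const_mul,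
      integral_const_mul, integral_const_mul] at h
    linarith
  have upper : √(d : ℝ) * ∫ x, |x i| ∂μ ≤ 1 := by
    have h : ∫ x, √(d : ℝ) * |x i| ∂μ ≤ ∫ x, (1 / 2 + (d : ℝ) / 2 * (x i) ^ 2) ∂μ := by
      refine integral_mono (hint (by fun_prop)) (hint (by fun_prop)) fun x => ?_
      have h : (√(d : ℝ) * |x i|) ^ 2 = d * (x i) ^ 2 := by rw [mul_pow, hr2, sq_abs]
      dsimp only
      nlinarith [sq_nonneg (√(d : ℝ) * |x i| - 1)]
    rw [integral_add (hint (by fun_prop)) (hint (by fun_prop)), integral_const_mul,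
      integral_const_mul] at h
    simp only [integral_const, probReal_univ, one_smul] at h
    linarith
  rw [hg, mul_comm ‖g‖]
  constructor
  · refine mul_le_mul_of_nonneg_right ?_ (norm_nonneg g)
    rw [div_le_iff₀ (by positivity)]
    linarith
  · refine mul_le_mul_of_nonneg_right ?_ (norm_nonneg g)
    rw [le_div_iff₀ hr]
    linarith
end

section
/- Let g : ℝ^d → ℝ be continuously differentiable. Let u be a random vector uniform on the unit sphere S^{d−1} and v a random vector uniform on the closed unit ball B^d = {x ∈ ℝ^d : ‖x‖ ≤ 1}. Then E[g(u)·u] = (1/d)·E[∇g(v)], i.e., the sphere average of g(u)u equals 1/d times the ball average of the gradient of g. -/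
open MeasureTheory

section IsometryInvariant

variable {F : Type*} [NormedAddCommGroup F] [InnerProductSpace ℝ F] [MeasurableSpace F]
  [BorelSpace F] {μ ν : Measure F}

/-- The characteristic function of an isometry-invariant measure is radial. -/
theorem charFun_eq_of_norm_eq (hμ : ∀ T : F ≃ₗᵢ[ℝ] F, μ.map T = μ) {a b : F}
    (hab : ‖a‖ = ‖b‖) : charFun μ a = charFun μ b := by
  set T := (ℝ ∙ (a - b))ᗮ.reflection with hT
  have hTa : T a = b := Submodule.reflection_sub hab
  have hTb : T b = a := by rw [← hTa, hT, Submodule.reflection_reflection]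
  conv_lhs => rw [← hμ T]
  rw [charFun_apply, charFun_apply, integral_map_of_stronglyMeasurable
    T.continuous.measurable (by fun_prop)]
  congr! 5 with x
  rw [← hTb, T.inner_map_map]

/-- An isometry-invariant measure is the law of `‖x‖ • u` with `x` drawn from that measure and `u`
independent and isometry-invariant on the unit sphere. -/
theorem map_norm_smul_prod_eq [FiniteDimensional ℝ F] [IsProbabilityMeasure μ] [IsFiniteMeasure ν]
    (hμs : ∀ᵐ x ∂μ, ‖x‖ = 1) (hμ : ∀ T : F ≃ₗᵢ[ℝ] F, μ.map T = μ)
    (hν : ∀ T : F ≃ₗᵢ[ℝ] F, ν.map T = ν) :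
    (ν.prod μ).map (fun p ↦ ‖p.1‖ • p.2) = ν := by
  have hF : ProperSpace F := FiniteDimensional.proper ℝ F
  apply Measure.ext_of_charFun
  ext ξ
  have hexp (f : F × F → ℝ) (hf : Continuous f) :
      Integrable (fun p ↦ Complex.exp (f p * Complex.I)) (ν.prod μ) := by
    refine Integrable.of_bound (C := 1) (by fun_prop) (.of_forall fun p ↦ ?_)
    rw [Complex.norm_exp_ofReal_mul_I]
  calc charFun ((ν.prod μ).map (fun p ↦ ‖p.1‖ • p.2)) ξ
      = ∫ p, Complex.exp (inner ℝ (‖p.1‖ • p.2) ξ * Complex.I) ∂(ν.prod μ) := by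
        rw [charFun_apply, integral_map_of_stronglyMeasurable (by fun_prop) (by fun_prop)]
    _ = ∫ x, charFun μ (‖x‖ • ξ) ∂ν := by
        rw [integral_prod _ (hexp _ (by fun_prop))]
        simp_rw [charFun_apply, real_inner_smul_left, real_inner_smul_right]
    _ = ∫ x, charFun μ (‖ξ‖ • x) ∂ν := by
        congr! 2 with x
        exact charFun_eq_of_norm_eq hμ (by simp [norm_smul, mul_comm])
    _ = ∫ x, ∫ u, Complex.exp (inner ℝ x (‖ξ‖ • u) * Complex.I) ∂μ ∂ν := by
        simp_rw [charFun_apply, real_inner_smul_right, real_inner_comm]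
    _ = ∫ u, charFun ν (‖ξ‖ • u) ∂μ := by
        rw [integral_integral_swap (hexp (fun p ↦ inner ℝ p.1 (‖ξ‖ • p.2)) (by fun_prop))]
        simp_rw [charFun_apply]
    _ = ∫ _, charFun ν ξ ∂μ := by
        refine integral_congr_ae (hμs.mono fun u hu ↦ ?_)
        exact charFun_eq_of_norm_eq hν (by simp [norm_smul, hu])
    _ = charFun ν ξ := by simp

theorem restrict_closedBall_of_ae_norm_eq_one {F : Type*} [NormedAddCommGroup F]
    [MeasurableSpace F] {μ : Measure F} (hμs : ∀ᵐ x ∂μ, ‖x‖ = 1) :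
    μ.restrict (Metric.closedBall 0 1) = μ :=
  Measure.restrict_eq_self_of_ae_mem (hμs.mono fun x hx ↦ by simp [hx])

theorem Continuous.integrable_of_ae_norm_eq_one_s3 [FiniteDimensional ℝ F] [IsFiniteMeasure μ]
    {G : Type*} [NormedAddCommGroup G]
    (hμs : ∀ᵐ x ∂μ, ‖x‖ = 1) {f : F → G} (hf : Continuous f) : Integrable f μ := by
  have hF : ProperSpace F := FiniteDimensional.proper ℝ F
  rw [← restrict_closedBall_of_ae_norm_eq_one hμs]
  exact hf.continuousOn.integrableOn_compact (isCompact_closedBall _ _)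

theorem continuous_integral_of_ae_norm_eq_one [FiniteDimensional ℝ F] [IsFiniteMeasure μ]
    (hμs : ∀ᵐ x ∂μ, ‖x‖ = 1) {f : ℝ → F → ℝ} (hf : Continuous f.uncurry) :
    Continuous fun t ↦ ∫ x, f t x ∂μ := by
  have hF : ProperSpace F := FiniteDimensional.proper ℝ F
  rw [← restrict_closedBall_of_ae_norm_eq_one hμs]
  exact continuous_parametric_integral_of_continuous hf (isCompact_closedBall _ _)

theorem hasDerivAt_integral_of_ae_norm_eq_one [FiniteDimensional ℝ F] [IsFiniteMeasure μ]
    (hμs : ∀ᵐ x ∂μ, ‖x‖ = 1) {f f' : ℝ → F → ℝ} (hf : ∀ t, Continuous (f t))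
    (hf' : Continuous f'.uncurry) (hff' : ∀ t x, HasDerivAt (f · x) (f' t x) t) (t : ℝ) :
    HasDerivAt (fun t ↦ ∫ x, f t x ∂μ) (∫ x, f' t x ∂μ) t := by
  have hF : ProperSpace F := FiniteDimensional.proper ℝ F
  obtain ⟨C, hC⟩ := ((isCompact_closedBall t 1).prod
    (isCompact_closedBall (0 : F) 1)).exists_bound_of_continuousOn hf'.continuousOn
  refine (hasDerivAt_integral_of_dominated_loc_of_deriv_le (bound := fun _ ↦ C)
    (Metric.closedBall_mem_nhds t one_pos) (.of_forall fun s ↦ (hf s).aestronglyMeasurable)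
    ((hf t).integrable_of_ae_norm_eq_one_s3 hμs) ?_ ?_ (integrable_const C)
    (.of_forall fun x s _ ↦ hff' s x)).2
  · exact (hf'.comp (Continuous.prodMk_right t)).aestronglyMeasurable
  · exact hμs.mono fun x hx s hs ↦ hC (s, x) ⟨hs, by simp [hx]⟩

/-- Invariance under the rotations in the plane of `a` and `b`, in infinitesimal form. -/
theorem integral_fderiv_rotation_eq_zero [FiniteDimensional ℝ F] [IsFiniteMeasure μ]
    (hμs : ∀ᵐ x ∂μ, ‖x‖ = 1) (hμ : ∀ T : F ≃ₗᵢ[ℝ] F, μ.map T = μ) {h : F → ℝ}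
    (hh : ContDiff ℝ 1 h) {a b : F} (ha : ‖a‖ = 1) (hb : ‖b‖ = 1) (hab : inner ℝ a b = 0) :
    ∫ x, fderiv ℝ h x (inner ℝ b x • a - inner ℝ a x • b) ∂μ = 0 := by
  let w : ℝ → F := fun t ↦ Real.cos t • a + Real.sin t • b
  let w' : ℝ → F := fun t ↦ -Real.sin t • a + Real.cos t • b
  have hw (t) : HasDerivAt w (w' t) t :=
    ((Real.hasDerivAt_cos t).smul_const a).add ((Real.hasDerivAt_sin t).smul_const b)
  have hw1 (t) : ‖w t‖ = 1 := by
    rw [← sq_eq_sq₀ (norm_nonneg _) zero_le_one, norm_add_sq_real]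
    simp [norm_smul, ha, hb, inner_smul_left, inner_smul_right, hab]
  have hwc : Continuous w := by fun_prop
  have hwc' : Continuous w' := by fun_prop
  let R : ℝ → F → F := fun t x ↦ x - (2 * inner ℝ (w t) x) • w t
  let R' : ℝ → F → F := fun t x ↦
    -((2 * inner ℝ (w t) x) • w' t + (2 * inner ℝ (w' t) x) • w t)
  have hR (t x) : HasDerivAt (R · x) (R' t x) t := by
    have h1 : HasDerivAt (fun t ↦ 2 * inner ℝ (w t) x) (2 * inner ℝ (w' t) x) t := by
      have := ((hw t).inner ℝ (hasDerivAt_const t x)).const_mul (2 : ℝ)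
      simpa using this
    exact (h1.smul (hw t)).const_sub x
  have hRrefl (t) (x) : (ℝ ∙ w t)ᗮ.reflection x = R t x := by
    rw [Submodule.reflection_orthogonal_apply, Submodule.reflection_singleton_apply]
    simp [R, hw1, mul_smul, two_smul]
  have hRmap (t : ℝ) (f : F → ℝ) (hf : Continuous f) :
      ∫ x, f (R t x) ∂μ = ∫ x, f x ∂μ := by
    conv_rhs => rw [← hμ (ℝ ∙ w t)ᗮ.reflection]
    rw [integral_map_of_stronglyMeasurable (by fun_prop) hf.stronglyMeasurable]
    simp_rw [hRrefl]
  have hd := hasDerivAt_integral_of_ae_norm_eq_one hμs (f := fun t x ↦ h (R t x))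
    (f' := fun t x ↦ fderiv ℝ h (R t x) (R' t x))
    (fun t ↦ hh.continuous.comp (by fun_prop))
    (by
      have := hh.continuous_fderiv one_ne_zero
      fun_prop)
    (fun t x ↦ ((hh.differentiable one_ne_zero _).hasFDerivAt).comp_hasDerivAt t (hR t x)) 0
  simp_rw [hRmap _ h hh.continuous] at hd
  have h0 := hd.unique (hasDerivAt_const _ _)
  have key (x) : R' 0 x = (-2 : ℝ) • (inner ℝ b (R 0 x) • a - inner ℝ a (R 0 x) • b) := by
    have hba : inner ℝ b a = 0 := by rw [real_inner_comm, hab]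
    simp [R, R', w, w', inner_sub_right, inner_smul_right, hba, ha]
    module
  simp_rw [key, map_smul] at h0
  rw [hRmap 0 (fun y ↦ (-2 : ℝ) • fderiv ℝ h y (inner ℝ b y • a - inner ℝ a y • b)) (by
      have := hh.continuous_fderiv one_ne_zero
      fun_prop), integral_smul] at h0
  simpa using h0

/-- Polar coordinates on the unit ball, for any isometry-invariant probability measure on the
sphere. -/
theorem integral_closedBall_eq_integral_integral [FiniteDimensional ℝ F] [Nontrivial F]
    [IsProbabilityMeasure μ]
    (hμs : ∀ᵐ x ∂μ, ‖x‖ = 1) (hμ : ∀ T : F ≃ₗᵢ[ℝ] F, μ.map T = μ) {f : F → ℝ}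
    (hf : Continuous f) :
    ∫ x in Metric.closedBall 0 1, f x = Module.finrank ℝ F * volume.real (Metric.ball (0 : F) 1) *
      ∫ r in (0 : ℝ)..1, r ^ (Module.finrank ℝ F - 1) * ∫ u, f (r • u) ∂μ := by
  have hF : ProperSpace F := FiniteDimensional.proper ℝ F
  set ν : Measure F := volume.restrict (Metric.closedBall 0 1) with hν
  have : IsFiniteMeasure ν := ⟨by simpa [hν] using measure_closedBall_lt_top⟩
  have hνinv (T : F ≃ₗᵢ[ℝ] F) : ν.map T = ν := by
    have := T.measurePreserving.restrict_preimage
      (Metric.isClosed_closedBall (x := (0 : F)) (ε := 1)).measurableSet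
    simpa using this.map_eq
  have hmap := map_norm_smul_prod_eq hμs hμ hνinv
  have hfi : Integrable f ν := hf.continuousOn.integrableOn_compact (isCompact_closedBall _ _)
  have hpi : Integrable (fun p : F × F ↦ f (‖p.1‖ • p.2)) (ν.prod μ) := by
    rw [← hmap] at hfi
    exact hfi.comp_measurable (by fun_prop)
  set φ : ℝ → ℝ := fun r ↦ ∫ u, f (r • u) ∂μ
  calc ∫ x, f x ∂ν = ∫ x, φ ‖x‖ ∂ν := by
        conv_lhs => rw [← hmap]
        rw [integral_map_of_stronglyMeasurable (by fun_prop) hf.stronglyMeasurable,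
          integral_prod _ hpi]
    _ = ∫ x : F, (Set.Iic 1).indicator φ ‖x‖ := by
        rw [hν, ← integral_indicator Metric.isClosed_closedBall.measurableSet]
        simp [Set.indicator]
    _ = _ := by
        rw [integral_fun_norm_addHaar, nsmul_eq_mul, smul_eq_mul, mul_assoc,
          intervalIntegral.integral_of_le zero_le_one, ← Set.Ioi_inter_Iic,
          ← setIntegral_indicator measurableSet_Iic]
        congr! 3
        ext r
        by_cases hr : r ≤ 1 <;> simp [hr, φ]

/-- Integration by parts on the sphere of radius `r`. -/
theorem finrank_sub_one_mul_integral_mul_inner [FiniteDimensional ℝ F] [IsFiniteMeasure μ]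
    (hμs : ∀ᵐ x ∂μ, ‖x‖ = 1) (hμ : ∀ T : F ≃ₗᵢ[ℝ] F, μ.map T = μ) {g : F → ℝ}
    (hg : ContDiff ℝ 1 g) {ι : Type*} [Fintype ι] (b : OrthonormalBasis ι ℝ F) (i : ι) (r : ℝ) :
    ((Module.finrank ℝ F - 1 : ℕ) : ℝ) * ∫ x, g (r • x) * inner ℝ (b i) x ∂μ =
      r * (∫ x, fderiv ℝ g (r • x) (b i) ∂μ -
        ∫ x, fderiv ℝ g (r • x) x * inner ℝ (b i) x ∂μ) := by
  classical
  have hgc := hg.continuous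
  have hgc' := hg.continuous_fderiv one_ne_zero
  let K : ι → F → ℝ := fun j x ↦ r * (inner ℝ (b j) x ^ 2 * fderiv ℝ g (r • x) (b i) -
    inner ℝ (b i) x * (inner ℝ (b j) x * fderiv ℝ g (r • x) (b j)))
  have hK (j) : ∫ x, K j x ∂μ = if j = i then 0 else ∫ x, g (r • x) * inner ℝ (b i) x ∂μ := by
    split_ifs with hj
    · subst hj
      refine integral_eq_zero_of_ae (.of_forall fun x ↦ ?_)
      simp only [K, Pi.zero_apply]
      ring
    · have h0 := integral_fderiv_rotation_eq_zero hμs hμ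
        (h := fun x ↦ g (r • x) * inner ℝ (b j) x)
        ((hg.comp (contDiff_const_smul r)).mul (contDiff_const.inner ℝ contDiff_id)) (b.norm_eq_one i)
        (b.norm_eq_one j) (b.inner_eq_zero (Ne.symm hj))
      rw [← sub_eq_zero, ← integral_sub (Continuous.integrable_of_ae_norm_eq_one_s3 hμs
        (by fun_prop)) (Continuous.integrable_of_ae_norm_eq_one_s3 hμs (by fun_prop)), ← h0]
      congr with x
      have h1 : HasFDerivAt (fun x ↦ g (r • x))
          ((fderiv ℝ g (r • x)).comp (r • ContinuousLinearMap.id ℝ F)) x :=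
        (hg.differentiable one_ne_zero (r • x)).hasFDerivAt.comp x
          ((hasFDerivAt_id x).const_smul r)
      have h2 : HasFDerivAt (fun x ↦ g (r • x) * inner ℝ (b j) x) _ x :=
        h1.mul (innerSL ℝ (b j)).hasFDerivAt
      rw [h2.fderiv]
      simp [K, inner_sub_right, inner_smul_right, b.inner_eq_zero hj]
      ring
  have hsum : ∫ x, ∑ j, K j x ∂μ = ∫ x, r * (fderiv ℝ g (r • x) (b i) -
      fderiv ℝ g (r • x) x * inner ℝ (b i) x) ∂μ := by
    refine integral_congr_ae (hμs.mono fun x hx ↦ ?_)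
    have h1 : ∑ j, inner ℝ (b j) x ^ 2 = 1 := by
      simpa [hx] using b.sum_sq_inner_right x
    have h2 : ∑ j, inner ℝ (b j) x * fderiv ℝ g (r • x) (b j) = fderiv ℝ g (r • x) x := by
      simpa using congrArg (fderiv ℝ g (r • x)) (b.sum_repr' x)
    simp only [K]
    rw [← Finset.mul_sum, Finset.sum_sub_distrib, ← Finset.sum_mul, ← Finset.mul_sum, h1, h2]
    ring
  rw [integral_finsetSum _ fun j _ ↦ Continuous.integrable_of_ae_norm_eq_one_s3 hμs (by fun_prop),
    integral_const_mul, integral_sub (Continuous.integrable_of_ae_norm_eq_one_s3 hμs (by fun_prop))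
    (Continuous.integrable_of_ae_norm_eq_one_s3 hμs (by fun_prop))] at hsum
  rw [← hsum, Module.finrank_eq_card_basis b.toBasis]
  simp [hK, Finset.sum_ite, Finset.filter_ne', Finset.card_univ]

/-- The divergence theorem on the unit ball, in the direction of a basis vector. -/
theorem integral_mul_inner_eq_integral_fderiv [FiniteDimensional ℝ F] [Nontrivial F]
    [IsProbabilityMeasure μ]
    (hμs : ∀ᵐ x ∂μ, ‖x‖ = 1) (hμ : ∀ T : F ≃ₗᵢ[ℝ] F, μ.map T = μ) {g : F → ℝ}
    (hg : ContDiff ℝ 1 g) {ι : Type*} [Fintype ι] (b : OrthonormalBasis ι ℝ F) (i : ι) :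
    Module.finrank ℝ F * volume.real (Metric.ball (0 : F) 1) *
      ∫ x, g x * inner ℝ (b i) x ∂μ =
      ∫ x in Metric.closedBall 0 1, fderiv ℝ g x (b i) := by
  have hgc := hg.continuous
  have hgc' := hg.continuous_fderiv one_ne_zero
  rw [integral_closedBall_eq_integral_integral hμs hμ (by fun_prop)]
  congr 1
  set n := Module.finrank ℝ F - 1
  let M : ℝ → ℝ := fun r ↦ ∫ x, g (r • x) * inner ℝ (b i) x ∂μ
  have hM (r) : HasDerivAt M (∫ x, fderiv ℝ g (r • x) x * inner ℝ (b i) x ∂μ) r := by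
    refine hasDerivAt_integral_of_ae_norm_eq_one hμs (by fun_prop)
      (f' := fun r x ↦ fderiv ℝ g (r • x) x * inner ℝ (b i) x) (by fun_prop) (fun r x ↦ ?_) r
    have h1 : HasDerivAt (fun r : ℝ ↦ r • x) x r := by
      simpa using (hasDerivAt_id r).smul_const x
    exact ((hg.differentiable one_ne_zero _).hasFDerivAt.comp_hasDerivAt r h1).mul_const _
  have hM0 : M 0 = 0 := by
    have h1 : ∫ x, inner ℝ (b i) x ∂μ = ∫ x, -inner ℝ (b i) x ∂μ := by
      conv_lhs => rw [← hμ (LinearIsometryEquiv.neg ℝ)]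
      rw [integral_map_of_stronglyMeasurable (by fun_prop) (by fun_prop)]
      simp
    rw [integral_neg] at h1
    simp only [M, zero_smul, integral_const_mul]
    rw [show ∫ x, inner ℝ (b i) x ∂μ = 0 by linarith, mul_zero]
  have hderiv (r : ℝ) (hr : r ∈ Set.Ioo (0 : ℝ) 1) : HasDerivAt (fun r ↦ r ^ n * M r)
      (r ^ n * ∫ x, fderiv ℝ g (r • x) (b i) ∂μ) r := by
    refine ((hasDerivAt_pow n r).mul (hM r)).congr_deriv ?_
    have h := finrank_sub_one_mul_integral_mul_inner hμs hμ hg b i r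
    have hpow (m : ℕ) : (m : ℝ) * r ^ (m - 1) * r = m * r ^ m := by
      cases m <;> simp [pow_succ, mul_assoc]
    refine mul_right_cancel₀ hr.1.ne' ?_
    linear_combination M r * hpow n + r ^ n * h
  have hc : Continuous fun r : ℝ ↦ ∫ x, fderiv ℝ g (r • x) (b i) ∂μ :=
    continuous_integral_of_ae_norm_eq_one hμs (by fun_prop)
  have hMc : Continuous M := continuous_iff_continuousAt.2 fun r ↦ (hM r).continuousAt
  rw [intervalIntegral.integral_eq_sub_of_hasDerivAt_of_le zero_le_one
    (by fun_prop) hderiv (Continuous.intervalIntegrable (by fun_prop) _ _)]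
  simp [hM0, M]

end IsometryInvariant

/-- For `g : ℝ^d → ℝ` continuously differentiable, `u` uniform
(rotation-invariant probability measure) on the unit sphere and `v` uniform
(normalized Lebesgue measure) on the closed unit ball,
`E[g(u)·u] = (1/d)·E[∇g(v)]`. -/
theorem stmt3 (d : ℕ) (hd : 0 < d)
    (g : EuclideanSpace ℝ (Fin d) → ℝ) (hg : ContDiff ℝ 1 g)
    (μ : Measure (EuclideanSpace ℝ (Fin d))) [IsProbabilityMeasure μ]
    (hsph : ∀ᵐ x ∂μ, ‖x‖ = 1)
    (hrot : ∀ T : EuclideanSpace ℝ (Fin d) ≃ₗᵢ[ℝ] EuclideanSpace ℝ (Fin d),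
      Measure.map (⇑T) μ = μ) :
    ∫ u, g u • u ∂μ =
      (1 / d : ℝ) •
        ∫ v, gradient g v
          ∂((volume (Metric.closedBall (0 : EuclideanSpace ℝ (Fin d)) 1))⁻¹ •
              volume.restrict (Metric.closedBall (0 : EuclideanSpace ℝ (Fin d)) 1)) := by
  have : Nonempty (Fin d) := ⟨⟨0, hd⟩⟩
  have hgc := hg.continuous
  have hgrad : Continuous (gradient g) :=
    (InnerProductSpace.toDual ℝ _).symm.continuous.comp (hg.continuous_fderiv one_ne_zero)
  set b := EuclideanSpace.basisFun (Fin d) ℝ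
  refine InnerProductSpace.ext_inner_left_basis (𝕜 := ℝ) b.toBasis fun i ↦ ?_
  have h := integral_mul_inner_eq_integral_fderiv hsph hrot hg b i
  have hgi : IntegrableOn (gradient g) (Metric.closedBall 0 1) :=
    hgrad.continuousOn.integrableOn_compact (isCompact_closedBall _ _)
  have hvol : volume.real (Metric.ball (0 : EuclideanSpace ℝ (Fin d)) 1) ≠ 0 :=
    ENNReal.toReal_ne_zero.2
      ⟨(Metric.measure_ball_pos volume _ one_pos).ne', measure_ball_lt_top.ne⟩
  rw [b.coe_toBasis, integral_smul_measure, inner_smul_right, inner_smul_right,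
    ← integral_inner hgi,
    ← integral_inner (Continuous.integrable_of_ae_norm_eq_one_s3 hsph (by fun_prop))]
  simp only [inner_smul_right, inner_gradient_right, conj_trivial]
  rw [← h, finrank_euclideanSpace_fin, ENNReal.toReal_inv,
    Measure.addHaar_closedBall_eq_addHaar_ball, ← measureReal_def]
  field_simp
end

section
/- Let f : ℝ^d → ℝ be convex and β-smooth. Then for every w, w* ∈ ℝ^d, every unit vector u ∈ S^{d−1}, and every γ > 0: ⟨∇f(w + γu) + ∇f(w − γu), w − w*⟩ ≥ 2(f(w) − f(w*)) − 2βγ². -/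
open scoped RealInnerProductSpace

/-- Three-point inequality: the gradient at `x` of a convex and `β`-smooth function, tested against
`w - z`, controls `f w - f z` up to a quadratic error in `‖w - x‖`. -/
theorem sub_le_inner_add_of_convex_of_smooth {E : Type*} [NormedAddCommGroup E]
    [InnerProductSpace ℝ E] {β : ℝ} {f : E → ℝ} {g : E → E}
    (hconv : ∀ x y, ⟪g x, y - x⟫ ≤ f y - f x)
    (hsmooth : ∀ x y, f y ≤ f x + ⟪g x, y - x⟫ + β / 2 * ‖y - x‖ ^ 2) (x w z : E) :
    f w - f z ≤ ⟪g x, w - z⟫ + β / 2 * ‖w - x‖ ^ 2 := by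
  have hsplit : ⟪g x, w - z⟫ = ⟪g x, w - x⟫ - ⟪g x, z - x⟫ := by
    rw [← inner_sub_right, sub_sub_sub_cancel_right]
  linarith [hconv x z, hsmooth x w]

/-- For a convex and `β`-smooth `f : ℝ^d → ℝ` (differentiable with gradient
`gradf`, satisfying the first-order convexity inequality and the quadratic upper bound),
every `w, w*`, every unit vector `u` and every `γ > 0`:
`⟨∇f(w + γu) + ∇f(w − γu), w − w*⟩ ≥ 2(f(w) − f(w*)) − 2βγ²`. -/
theorem stmt6 (d : ℕ) (β : ℝ) (hβ : 0 < β)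
    (f : EuclideanSpace ℝ (Fin d) → ℝ)
    (gradf : EuclideanSpace ℝ (Fin d) → EuclideanSpace ℝ (Fin d))
    (hdiff : ∀ x, HasGradientAt f (gradf x) x)
    (hconvf : ∀ x y, ⟪gradf x, y - x⟫ ≤ f y - f x)
    (hsmooth : ∀ x y, f y ≤ f x + ⟪gradf x, y - x⟫ + β / 2 * ‖y - x‖ ^ 2)
    (w wstar u : EuclideanSpace ℝ (Fin d)) (hu : ‖u‖ = 1) (γ : ℝ) (hγ : 0 < γ) :
    2 * (f w - f wstar) - 2 * β * γ ^ 2 ≤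
      ⟪gradf (w + γ • u) + gradf (w - γ • u), w - wstar⟫ := by
  have hplus := sub_le_inner_add_of_convex_of_smooth hconvf hsmooth (w + γ • u) w wstar
  have hminus := sub_le_inner_add_of_convex_of_smooth hconvf hsmooth (w - γ • u) w wstar
  have hnorm : ‖γ • u‖ = γ := by rw [norm_smul, hu, mul_one, Real.norm_of_nonneg hγ.le]
  rw [sub_add_cancel_left, norm_neg, hnorm] at hplus
  rw [sub_sub_cancel, hnorm] at hminus
  rw [inner_add_left]
  linarith [mul_pos hβ (pow_pos hγ 2)]
end

section
/- Let ρ : ℝ → ℝ and f : ℝ^d → ℝ be continuously differentiable, let w ∈ ℝ^d and γ > 0. Let u be uniform on the unit sphere S^{d−1} and v uniform on the closed unit ball B^d. Then E[ρ(f(w + γu) − f(w − γu))·u] = (γ/d)·E[ρ'(f(w + γv) − f(w − γv))·(∇f(w + γv) + ∇f(w − γv))]. -/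
open MeasureTheory
open scoped Topology

theorem charFun_eq_of_norm_eq_s8 {E : Type*} [NormedAddCommGroup E] [InnerProductSpace ℝ E]
    [MeasurableSpace E] [BorelSpace E] {m : Measure E}
    (hm : ∀ T : E ≃ₗᵢ[ℝ] E, m.map T = m) {s t : E} (hst : ‖s‖ = ‖t‖) :
    charFun m s = charFun m t := by
  set R : E ≃ₗᵢ[ℝ] E := (ℝ ∙ (s - t))ᗮ.reflection
  have hR : R s = t := Submodule.reflection_sub hst
  rw [charFun_apply, charFun_apply, ← hR]
  conv_rhs => rw [← hm R]
  rw [integral_map R.continuous.measurable.aemeasurable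
    (Continuous.aestronglyMeasurable (by fun_prop))]
  simp

/-- A finite rotation-invariant measure is recovered from its radial part and any
rotation-invariant probability measure on the unit sphere. -/
theorem map_norm_smul_prod_eq_s8 {E : Type*} [NormedAddCommGroup E] [InnerProductSpace ℝ E]
    [MeasurableSpace E] [BorelSpace E] [SecondCountableTopology E] [CompleteSpace E]
    {m μ : Measure E} [IsFiniteMeasure m] [IsProbabilityMeasure μ]
    (hm : ∀ T : E ≃ₗᵢ[ℝ] E, m.map T = m) (hμ : ∀ T : E ≃ₗᵢ[ℝ] E, μ.map T = μ)
    (hsph : ∀ᵐ x ∂μ, ‖x‖ = 1) :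
    (m.prod μ).map (fun p ↦ ‖p.1‖ • p.2) = m := by
  have hmeas : Measurable fun p : E × E ↦ ‖p.1‖ • p.2 :=
    (continuous_fst.norm.smul continuous_snd).measurable
  refine Measure.ext_of_charFun (funext fun ξ ↦ ?_)
  have hint : Integrable
      (fun p : E × E ↦ Complex.exp (inner ℝ p.2 (‖ξ‖ • p.1) * Complex.I)) (m.prod μ) := by
    refine Integrable.of_bound (C := 1) (Continuous.aestronglyMeasurable (by fun_prop)) ?_
    exact .of_forall fun p ↦ by simp [Complex.norm_exp_ofReal_mul_I]
  have hint' : Integrable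
      (fun p : E × E ↦ Complex.exp (inner ℝ (‖p.1‖ • p.2) ξ * Complex.I)) (m.prod μ) := by
    refine Integrable.of_bound (C := 1) (Continuous.aestronglyMeasurable (by fun_prop)) ?_
    exact .of_forall fun p ↦ by simp [Complex.norm_exp_ofReal_mul_I]
  calc charFun ((m.prod μ).map fun p ↦ ‖p.1‖ • p.2) ξ
      = ∫ x, ∫ u, Complex.exp (inner ℝ (‖x‖ • u) ξ * Complex.I) ∂μ ∂m := by
        rw [charFun_apply, integral_map hmeas.aemeasurable
          (Continuous.aestronglyMeasurable (by fun_prop)), integral_prod _ hint']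
    _ = ∫ x, charFun μ (‖x‖ • ξ) ∂m := by
        simp only [charFun_apply, real_inner_smul_left, real_inner_smul_right]
    _ = ∫ x, charFun μ (‖ξ‖ • x) ∂m := by
        refine integral_congr_ae (.of_forall fun x ↦ charFun_eq_of_norm_eq_s8 hμ ?_)
        simp [norm_smul, mul_comm]
    _ = ∫ u, charFun m (‖ξ‖ • u) ∂μ := by
        simp only [charFun_apply]
        rw [integral_integral_swap hint]
        simp only [real_inner_smul_right, real_inner_comm]
    _ = ∫ u, charFun m ξ ∂μ := by
        refine integral_congr_ae ?_
        filter_upwards [hsph] with u hu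
        exact charFun_eq_of_norm_eq_s8 hm (by simp [norm_smul, hu])
    _ = charFun m ξ := by simp

theorem continuous_integral_of_ae_norm_eq_one_s8 {E : Type*} [NormedAddCommGroup E]
    [InnerProductSpace ℝ E] [FiniteDimensional ℝ E] [MeasurableSpace E] [BorelSpace E]
    {μ : Measure E} [IsFiniteMeasure μ] (hsph : ∀ᵐ x ∂μ, ‖x‖ = 1)
    {g : ℝ → E → ℝ} (hg : Continuous g.uncurry) :
    Continuous fun r : ℝ ↦ ∫ u, g r u ∂μ := by
  have h : μ.restrict (Metric.sphere 0 1) = μ :=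
    Measure.restrict_eq_self_of_ae_mem (by simpa using hsph)
  rw [← h]
  exact continuous_parametric_integral_of_continuous hg (isCompact_sphere 0 1)

/-- Integration over the unit ball in polar coordinates. -/
theorem setIntegral_closedBall_eq_polar {E : Type*} [NormedAddCommGroup E]
    [InnerProductSpace ℝ E] [FiniteDimensional ℝ E] [Nontrivial E]
    [MeasurableSpace E] [BorelSpace E]
    {μ : Measure E} [IsProbabilityMeasure μ] (hμ : ∀ T : E ≃ₗᵢ[ℝ] E, μ.map T = μ)
    (hsph : ∀ᵐ x ∂μ, ‖x‖ = 1) {F : E → ℝ} (hF : Continuous F) :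
    ∫ x in Metric.closedBall 0 1, F x =
      Module.finrank ℝ E * volume.real (Metric.closedBall (0 : E) 1) *
        ∫ r in (0 : ℝ)..1, r ^ (Module.finrank ℝ E - 1) * ∫ u, F (r • u) ∂μ := by
  set B := Metric.closedBall (0 : E) 1
  have : IsFiniteMeasure (volume.restrict B) := ⟨by simpa using measure_closedBall_lt_top⟩
  have hm : ∀ T : E ≃ₗᵢ[ℝ] E, (volume.restrict B).map T = volume.restrict B := fun T ↦ by
    have h := T.measurePreserving.restrict_preimage (s := B) Metric.isClosed_closedBall.measurableSet
    have hB : T ⁻¹' B = B := by ext; simp [B]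
    rw [hB] at h
    exact h.map_eq
  have hcont : Continuous fun p : E × E ↦ ‖p.1‖ • p.2 := continuous_fst.norm.smul continuous_snd
  have hpolar := map_norm_smul_prod_eq_s8 hm hμ hsph
  have hint : Integrable F (volume.restrict B) :=
    hF.continuousOn.integrableOn_compact (isCompact_closedBall 0 1)
  rw [← hpolar] at hint
  conv_lhs => rw [← hpolar]
  have hint' : Integrable (fun p : E × E ↦ F (‖p.1‖ • p.2)) ((volume.restrict B).prod μ) :=
    hint.comp_measurable hcont.measurable
  rw [integral_map hcont.measurable.aemeasurable hF.aestronglyMeasurable, integral_prod _ hint']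
  set J : ℝ → ℝ := fun r ↦ ∫ u, F (r • u) ∂μ
  have hind : ∫ x in B, J ‖x‖ = ∫ x : E, (Set.Iic 1).indicator J ‖x‖ := by
    rw [← integral_indicator Metric.isClosed_closedBall.measurableSet]
    congr 1 with x
    by_cases hx : ‖x‖ ≤ 1 <;> simp [hx]
  have hball : volume.real (Metric.ball (0 : E) 1) = volume.real B := by
    rw [measureReal_def, measureReal_def, Measure.addHaar_closedBall_eq_addHaar_ball]
  change ∫ x in B, J ‖x‖ = _
  rw [hind, integral_fun_norm_addHaar, hball, intervalIntegral.integral_of_le zero_le_one,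
    nsmul_eq_mul, smul_eq_mul, mul_assoc, ← Set.Ioi_inter_Iic,
    ← setIntegral_indicator measurableSet_Iic]
  simp only [Set.indicator_apply, smul_eq_mul, mul_ite, mul_zero]
  rfl

theorem tendsto_integral_peak_at_one {q : ℝ → ℝ} (hq : Continuous q) :
    Filter.Tendsto
      (fun n : ℕ ↦ ∫ r in (0 : ℝ)..1, 2 * (1 - r ^ (n + 1)) * q r * ((n + 1 : ℕ) * r ^ n))
      Filter.atTop (𝓝 (q 1)) := by
  have hsubst : ∀ n : ℕ,
      ∫ r in (0 : ℝ)..1, 2 * (1 - r ^ (n + 1)) * q r * ((n + 1 : ℕ) * r ^ n) =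
        ∫ s in (0 : ℝ)..1, 2 * (1 - s) * q (s ^ (((n + 1 : ℕ) : ℝ)⁻¹)) := fun n ↦ by
    have hroot : Continuous fun s : ℝ ↦ s ^ (((n + 1 : ℕ) : ℝ)⁻¹) :=
      Real.continuous_rpow_const (by positivity)
    have h := intervalIntegral.integral_comp_mul_deriv (a := 0) (b := 1)
      (f := fun r : ℝ ↦ r ^ (n + 1)) (f' := fun r : ℝ ↦ (n + 1 : ℕ) * r ^ n)
      (g := fun s ↦ 2 * (1 - s) * q (s ^ (((n + 1 : ℕ) : ℝ)⁻¹)))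
      (fun r _ ↦ by simpa using hasDerivAt_pow (n + 1) r) (by fun_prop) (by fun_prop)
    simp only [zero_pow n.succ_ne_zero, one_pow] at h
    rw [← h]
    refine intervalIntegral.integral_congr fun r hr ↦ ?_
    rw [Set.uIcc_of_le zero_le_one] at hr
    simp only [Function.comp_apply, Real.pow_rpow_inv_natCast hr.1 n.succ_ne_zero]
  simp only [hsubst]
  have hlim : ∫ s in (0 : ℝ)..1, 2 * (1 - s) * q 1 = q 1 := by
    have : ∫ s in (0 : ℝ)..1, (1 - s) = 1 / 2 := by
      rw [intervalIntegral.integral_sub (by simp) (by simp)]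
      norm_num
    rw [intervalIntegral.integral_mul_const, intervalIntegral.integral_const_mul, this]
    ring
  obtain ⟨C, hC⟩ := (isCompact_Icc (a := (0 : ℝ)) (b := 1)).exists_bound_of_continuousOn
    hq.continuousOn
  rw [← hlim]
  refine intervalIntegral.tendsto_integral_filter_of_dominated_convergence (fun _ ↦ 2 * C)
    (.of_forall fun n ↦ ?_) (.of_forall fun n ↦ .of_forall fun s hs ↦ ?_) (by simp)
    (.of_forall fun s hs ↦ ?_)
  · have hroot : Continuous fun s : ℝ ↦ s ^ (((n + 1 : ℕ) : ℝ)⁻¹) :=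
      Real.continuous_rpow_const (by positivity)
    exact Continuous.aestronglyMeasurable (by fun_prop)
  · rw [Set.uIoc_of_le zero_le_one] at hs
    have hmem : s ^ (((n + 1 : ℕ) : ℝ)⁻¹) ∈ Set.Icc (0 : ℝ) 1 :=
      ⟨Real.rpow_nonneg hs.1.le _, Real.rpow_le_one hs.1.le hs.2 (by positivity)⟩
    rw [norm_mul]
    gcongr
    · rw [Real.norm_eq_abs, abs_le]
      constructor <;> linarith [hs.1, hs.2]
    · exact hC _ hmem
  · rw [Set.uIoc_of_le zero_le_one] at hs
    refine (Filter.Tendsto.const_mul _ ?_)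
    refine (hq.tendsto 1).comp ?_
    have hexp : Filter.Tendsto (fun n : ℕ ↦ ((n + 1 : ℕ) : ℝ)⁻¹) Filter.atTop (𝓝 0) :=
      tendsto_inv_atTop_zero.comp
        (tendsto_natCast_atTop_atTop.comp (Filter.tendsto_add_atTop_nat 1))
    simpa using tendsto_const_nhds.rpow hexp (Or.inl hs.1.ne')

theorem hasDerivAt_max_zero_sq (y : ℝ) :
    HasDerivAt (fun y : ℝ ↦ (max 0 y) ^ 2) (2 * max 0 y) y := by
  rcases lt_trichotomy y 0 with hy | rfl | hy
  · rw [max_eq_left hy.le, mul_zero]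
    refine (hasDerivAt_const y (0 : ℝ)).congr_of_eventuallyEq ?_
    filter_upwards [gt_mem_nhds hy] with z hz
    simp [max_eq_left hz.le]
  · rw [max_self, mul_zero, hasDerivAt_iff_isLittleO_nhds_zero]
    refine Asymptotics.IsBigO.trans_isLittleO (g := fun h : ℝ ↦ h ^ 2) ?_ ?_
    · refine Asymptotics.IsBigO.of_bound 1 (.of_forall fun h ↦ ?_)
      rcases le_total h 0 with hh | hh
      · simp [max_eq_left hh, sq_nonneg]
      · simp [max_eq_right hh]
    · simpa using Asymptotics.isLittleO_pow_id (𝕜 := ℝ) one_lt_two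
  · rw [max_eq_right hy.le]
    refine HasDerivAt.congr_of_eventuallyEq (f := fun y ↦ y ^ 2)
      (by simpa using hasDerivAt_pow 2 y) ?_
    filter_upwards [lt_mem_nhds hy] with z hz
    simp [max_eq_right hz.le]

/-- A `C¹` radial function supported in the closed unit ball; as `n → ∞` it tends to the indicator
function of the open unit ball. -/
noncomputable def ballCutoff {E : Type*} [NormedAddCommGroup E] (n : ℕ) (x : E) : ℝ :=
  (max 0 (1 - (‖x‖ ^ 2) ^ (n + 1))) ^ 2

section ballCutoff

variable {E : Type*} [NormedAddCommGroup E]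

theorem ballCutoff_eq_zero (n : ℕ) {x : E} (hx : x ∉ Metric.closedBall (0 : E) 1) :
    ballCutoff n x = 0 := by
  have hx : 1 < ‖x‖ := by simpa using hx
  have : 1 ≤ (‖x‖ ^ 2) ^ (n + 1) := one_le_pow₀ (one_le_pow₀ hx.le)
  simp [ballCutoff, this]

theorem abs_ballCutoff_le_one (n : ℕ) (x : E) : |ballCutoff n x| ≤ 1 := by
  rw [ballCutoff, abs_of_nonneg (by positivity)]
  refine pow_le_one₀ (le_max_left _ _) (max_le zero_le_one ?_)
  have : 0 ≤ (‖x‖ ^ 2) ^ (n + 1) := by positivity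
  linarith

theorem tendsto_ballCutoff {x : E} (hx : ‖x‖ < 1) :
    Filter.Tendsto (fun n ↦ ballCutoff n x) Filter.atTop (𝓝 1) := by
  have h : Filter.Tendsto (fun n : ℕ ↦ (‖x‖ ^ 2) ^ (n + 1)) Filter.atTop (𝓝 0) :=
    (tendsto_pow_atTop_nhds_zero_of_lt_one (by positivity)
      (pow_lt_one₀ (norm_nonneg x) hx two_ne_zero)).comp (Filter.tendsto_add_atTop_nat 1)
  simpa [ballCutoff] using ((tendsto_const_nhds (x := (0 : ℝ))).max (h.const_sub 1)).pow 2

theorem hasCompactSupport_ballCutoff [ProperSpace E] (n : ℕ) :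
    HasCompactSupport (ballCutoff n : E → ℝ) :=
  .intro (isCompact_closedBall 0 1) fun _ ↦ ballCutoff_eq_zero n

variable [InnerProductSpace ℝ E]

theorem hasFDerivAt_ballCutoff (n : ℕ) (x : E) :
    HasFDerivAt (ballCutoff n)
      ((2 * max 0 (1 - (‖x‖ ^ 2) ^ (n + 1)) * -((n + 1 : ℕ) * (‖x‖ ^ 2) ^ n)) •
        (2 • innerSL ℝ x)) x := by
  have h : HasDerivAt (fun t : ℝ ↦ (max 0 (1 - t ^ (n + 1))) ^ 2)
      (2 * max 0 (1 - (‖x‖ ^ 2) ^ (n + 1)) * -((n + 1 : ℕ) * (‖x‖ ^ 2) ^ n)) (‖x‖ ^ 2) :=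
    (hasDerivAt_max_zero_sq _).comp (‖x‖ ^ 2) ((hasDerivAt_pow (n + 1) (‖x‖ ^ 2)).const_sub 1)
  exact h.comp_hasFDerivAt x (hasStrictFDerivAt_norm_sq x).hasFDerivAt

end ballCutoff

/-- The divergence theorem on the unit ball. -/
theorem setIntegral_closedBall_fderiv_apply {E : Type*} [NormedAddCommGroup E]
    [InnerProductSpace ℝ E] [FiniteDimensional ℝ E] [Nontrivial E]
    [MeasurableSpace E] [BorelSpace E]
    {μ : Measure E} [IsProbabilityMeasure μ] (hμ : ∀ T : E ≃ₗᵢ[ℝ] E, μ.map T = μ)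
    (hsph : ∀ᵐ x ∂μ, ‖x‖ = 1) {h : E → ℝ} (hh : ContDiff ℝ 1 h) (v : E) :
    ∫ x in Metric.closedBall 0 1, fderiv ℝ h x v =
      Module.finrank ℝ E * volume.real (Metric.closedBall (0 : E) 1) *
        ∫ u, inner ℝ u v * h u ∂μ := by
  set B := Metric.closedBall (0 : E) 1
  have hBmeas : MeasurableSet B := Metric.isClosed_closedBall.measurableSet
  have hhc := hh.continuous
  have hh' : Continuous fun x ↦ fderiv ℝ h x v :=
    (hh.continuous_fderiv one_ne_zero).clm_apply continuous_const
  set q : ℝ → ℝ := fun r ↦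
    r ^ (Module.finrank ℝ E - 1) * ∫ u, inner ℝ u v * h (r • u) ∂μ
  have hq : Continuous q := by
    refine (continuous_pow _).mul
      (continuous_integral_of_ae_norm_eq_one_s8 hsph (g := fun r u ↦ inner ℝ u v * h (r • u)) ?_)
    simp only [Function.uncurry_def]
    fun_prop
  have hparts : ∀ n : ℕ, ∫ x in B, ballCutoff n x * fderiv ℝ h x v =
      Module.finrank ℝ E * volume.real B *
        ∫ r in (0 : ℝ)..1, 2 * (1 - r ^ (2 * n + 1 + 1)) * q r *
          ((2 * n + 1 + 1 : ℕ) * r ^ (2 * n + 1)) := fun n ↦ by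
    have hφ' : ∀ x : E, fderiv ℝ (ballCutoff n) x v =
        2 * max 0 (1 - (‖x‖ ^ 2) ^ (n + 1)) * -((n + 1 : ℕ) * (‖x‖ ^ 2) ^ n) *
          (2 * inner ℝ x v) := fun x ↦ by
      rw [(hasFDerivAt_ballCutoff n x).fderiv]
      simp
    have hdiff : Differentiable ℝ (ballCutoff n : E → ℝ) :=
      fun x ↦ (hasFDerivAt_ballCutoff n x).differentiableAt
    have hsupp := hasCompactSupport_ballCutoff (E := E) n
    have hφ'c : Continuous fun x : E ↦ fderiv ℝ (ballCutoff n) x v := by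
      simp only [hφ']
      fun_prop
    have hibp := integral_mul_fderiv_eq_neg_fderiv_mul_of_integrable (μ := volume) (v := v)
      (f := ballCutoff n) (g := h)
      ((hφ'c.mul hhc).integrable_of_hasCompactSupport (hsupp.fderiv_apply ℝ v).mul_right)
      ((hdiff.continuous.mul hh').integrable_of_hasCompactSupport hsupp.mul_right)
      ((hdiff.continuous.mul hhc).integrable_of_hasCompactSupport hsupp.mul_right)
      (fun x _ ↦ hdiff x) (fun x _ ↦ hh.differentiable one_ne_zero x)
    set F : E → ℝ := fun x ↦
      2 * (1 - (‖x‖ ^ 2) ^ (n + 1)) * ((n + 1 : ℕ) * (‖x‖ ^ 2) ^ n) * (2 * inner ℝ x v) * h x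
    have hF : Continuous F := by fun_prop
    calc ∫ x in B, ballCutoff n x * fderiv ℝ h x v
        = ∫ x, ballCutoff n x * fderiv ℝ h x v :=
          setIntegral_eq_integral_of_forall_compl_eq_zero fun x hx ↦ by
            rw [ballCutoff_eq_zero n hx, zero_mul]
      _ = ∫ x, -(fderiv ℝ (ballCutoff n) x v * h x) := by rw [hibp, integral_neg]
      _ = ∫ x in B, -(fderiv ℝ (ballCutoff n) x v * h x) := by
          refine (setIntegral_eq_integral_of_forall_compl_eq_zero fun x hx ↦ ?_).symm
          have hx : 1 < ‖x‖ := by simpa [B] using hx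
          have : 1 ≤ (‖x‖ ^ 2) ^ (n + 1) := one_le_pow₀ (one_le_pow₀ hx.le)
          simp [hφ', this]
      _ = ∫ x in B, F x := by
          refine setIntegral_congr_fun hBmeas fun x hx ↦ ?_
          have hx : ‖x‖ ≤ 1 := by simpa [B] using hx
          have : (‖x‖ ^ 2) ^ (n + 1) ≤ 1 :=
            pow_le_one₀ (by positivity) (pow_le_one₀ (norm_nonneg x) hx)
          simp only [hφ', F, max_eq_right (sub_nonneg.2 this)]
          ring
      _ = _ := by
          rw [setIntegral_closedBall_eq_polar hμ hsph hF]
          congr 1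
          refine intervalIntegral.integral_congr fun r _ ↦ ?_
          have hFr : ∫ u, F (r • u) ∂μ = ∫ u, 2 * (1 - r ^ (2 * n + 1 + 1)) *
              ((2 * n + 1 + 1 : ℕ) * r ^ (2 * n + 1)) * (inner ℝ u v * h (r • u)) ∂μ := by
            refine integral_congr_ae ?_
            filter_upwards [hsph] with u hu
            simp only [F, norm_smul, hu, mul_one, Real.norm_eq_abs, sq_abs, real_inner_smul_left]
            simp only [← pow_mul]
            push_cast
            ring
          simp only [hFr, integral_const_mul, q]
          ring
  have hleft : Filter.Tendsto (fun n ↦ ∫ x in B, ballCutoff n x * fderiv ℝ h x v) Filter.atTop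
      (𝓝 (∫ x in B, fderiv ℝ h x v)) := by
    refine tendsto_integral_of_dominated_convergence (fun x ↦ ‖fderiv ℝ h x v‖) (fun n ↦ ?_)
      (hh'.norm.continuousOn.integrableOn_compact (isCompact_closedBall 0 1))
      (fun n ↦ .of_forall fun x ↦ ?_) ?_
    · have hdiff : Differentiable ℝ (ballCutoff n : E → ℝ) :=
        fun x ↦ (hasFDerivAt_ballCutoff n x).differentiableAt
      exact (hdiff.continuous.mul hh').aestronglyMeasurable
    · rw [norm_mul]
      exact mul_le_of_le_one_left (norm_nonneg _) (abs_ballCutoff_le_one n x)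
    · have hne : ∀ᵐ x ∂volume.restrict B, x ∉ Metric.sphere (0 : E) 1 :=
        ae_restrict_of_ae (measure_eq_zero_iff_ae_notMem.1 (Measure.addHaar_sphere _ 0 1))
      filter_upwards [hne, ae_restrict_mem hBmeas] with x hx hxB
      have hx1 : ‖x‖ < 1 :=
        lt_of_le_of_ne (by simpa [B] using hxB) (by simpa using hx)
      simpa using (tendsto_ballCutoff hx1).mul_const (fderiv ℝ h x v)
  have hindex : Filter.Tendsto (fun n : ℕ ↦ 2 * n + 1) Filter.atTop Filter.atTop :=
    Filter.tendsto_atTop_mono (fun n ↦ by simp only [id]; omega) Filter.tendsto_id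
  have hright := ((tendsto_integral_peak_at_one hq).comp hindex).const_mul
    (Module.finrank ℝ E * volume.real B)
  simp only [hparts] at hleft
  simpa [q] using tendsto_nhds_unique hleft hright

/-- For continuously differentiable `ρ : ℝ → ℝ` and `f : ℝ^d → ℝ`,
`w ∈ ℝ^d`, `γ > 0`, `u` uniform (rotation-invariant probability measure) on the unit
sphere and `v` uniform (normalized Lebesgue) on the closed unit ball,
`E[ρ(f(w+γu) − f(w−γu))·u] = (γ/d)·E[ρ'(f(w+γv) − f(w−γv))·(∇f(w+γv) + ∇f(w−γv))]`. -/
theorem stmt8 (d : ℕ) (hd : 0 < d)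
    (ρ : ℝ → ℝ) (hρ : ContDiff ℝ 1 ρ)
    (f : EuclideanSpace ℝ (Fin d) → ℝ) (hf : ContDiff ℝ 1 f)
    (w : EuclideanSpace ℝ (Fin d)) (γ : ℝ) (hγ : 0 < γ)
    (μ : Measure (EuclideanSpace ℝ (Fin d))) [IsProbabilityMeasure μ]
    (hsph : ∀ᵐ x ∂μ, ‖x‖ = 1)
    (hrot : ∀ T : EuclideanSpace ℝ (Fin d) ≃ₗᵢ[ℝ] EuclideanSpace ℝ (Fin d),
      Measure.map (⇑T) μ = μ) :
    ∫ u, ρ (f (w + γ • u) - f (w - γ • u)) • u ∂μ =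
      (γ / d) •
        ∫ v, deriv ρ (f (w + γ • v) - f (w - γ • v)) •
            (gradient f (w + γ • v) + gradient f (w - γ • v))
          ∂((volume (Metric.closedBall (0 : EuclideanSpace ℝ (Fin d)) 1))⁻¹ •
              volume.restrict (Metric.closedBall (0 : EuclideanSpace ℝ (Fin d)) 1)) := by
  have : Nonempty (Fin d) := ⟨⟨0, hd⟩⟩
  set B := Metric.closedBall (0 : EuclideanSpace ℝ (Fin d)) 1
  set h : EuclideanSpace ℝ (Fin d) → ℝ := fun x ↦ ρ (f (w + γ • x) - f (w - γ • x))
  have hh : ContDiff ℝ 1 h := by fun_prop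
  have hhc := hh.continuous
  have hgrad : ∀ x v, fderiv ℝ h x v = inner ℝ v (γ •
      deriv ρ (f (w + γ • x) - f (w - γ • x)) •
        (gradient f (w + γ • x) + gradient f (w - γ • x))) := fun x v ↦ by
    have hρ' := (hρ.differentiable one_ne_zero (f (w + γ • x) - f (w - γ • x))).hasDerivAt
    have hf' := fun y ↦ (hf.differentiable one_ne_zero y).hasFDerivAt
    have hlin : HasFDerivAt (fun x : EuclideanSpace ℝ (Fin d) ↦ γ • x)
        (γ • ContinuousLinearMap.id ℝ _) x := (hasFDerivAt_id x).const_smul γ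
    have hp := (hf' (w + γ • x)).comp x (hlin.const_add w)
    have hm := (hf' (w - γ • x)).comp x (hlin.const_sub w)
    have := hρ'.comp_hasFDerivAt x (hp.sub hm)
    rw [HasFDerivAt.fderiv (f := h) this]
    simp only [inner_smul_right, inner_add_right, inner_gradient_right]
    simp
    ring
  have hcontgrad : Continuous fun x ↦ deriv ρ (f (w + γ • x) - f (w - γ • x)) •
      (gradient f (w + γ • x) + gradient f (w - γ • x)) := by
    have h1 := hρ.continuous_deriv le_rfl
    have h2 : Continuous (gradient f) :=
      (InnerProductSpace.toDual ℝ _).symm.continuous.comp (hf.continuous_fderiv one_ne_zero)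
    have h3 := hf.continuous
    fun_prop
  have hintμ : Integrable (fun u ↦ h u • u) μ := by
    have hres : μ.restrict (Metric.sphere 0 1) = μ :=
      Measure.restrict_eq_self_of_ae_mem (by simpa using hsph)
    rw [← hres]
    exact (hhc.smul continuous_id).continuousOn.integrableOn_compact (isCompact_sphere 0 1)
  have hintB := hcontgrad.continuousOn.integrableOn_compact (μ := volume)
    (isCompact_closedBall (0 : EuclideanSpace ℝ (Fin d)) 1)
  have hV : volume.real B ≠ 0 := by
    simpa [measureReal_def, ENNReal.toReal_eq_zero_iff, B, measure_closedBall_lt_top.ne] using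
      (Metric.measure_closedBall_pos volume (0 : EuclideanSpace ℝ (Fin d)) one_pos).ne'
  have hd' : (d : ℝ) ≠ 0 := by positivity
  refine ext_inner_left ℝ fun v ↦ ?_
  have hdiv := setIntegral_closedBall_fderiv_apply hrot hsph hh v
  simp only [hgrad, inner_smul_right _ _ γ, integral_const_mul, finrank_euclideanSpace_fin] at hdiv
  rw [integral_inner hintB] at hdiv
  rw [← integral_inner hintμ, integral_smul_measure, inner_smul_right, inner_smul_right,
    ENNReal.toReal_inv, ← measureReal_def]
  have hswap : ∫ u, inner ℝ v (h u • u) ∂μ = ∫ u, inner ℝ u v * h u ∂μ := by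
    simp only [inner_smul_right, real_inner_comm, mul_comm]
  rw [hswap]
  field_simp
  linear_combination -hdiv
end

section
/- (Descent-direction lower bound, eq. lb4.) Let 𝒟 ⊆ ℝ^d be convex with Euclidean diameter D, let f : 𝒟 → ℝ be convex, β-smooth and L-Lipschitz, and let w* be a minimizer of f over 𝒟. Let ρ : ℝ → [−1, 1] be a transfer function that is differentiable, anti-symmetric, with ρ(0) = 0, sign(ρ(x)) = sign(x) for x ≠ 0, and such that there are constants p ≥ 1 and r, c_ρ > 0 with ρ'(x) ≥ c_ρ·p·|x|^{p−1} for all x ∈ (−r, r). Fix w ∈ 𝒟 with f(w) − f(w*) > ε, set c̃ = 1/20 and γ = c̃ε/(β√d·D), and assume 2Lγ ≤ r. Let u be uniform on the unit sphere S^{d−1} and let o ∈ {±1} be a random sign with E[o | u] = ρ(f(w + γu) − f(w − γu)). Then ⟨E[o·u], w − w*⟩ ≥ p·c_ρ·c̃^{2p−1}·ε^{2p} / (d^{(2p+1)/2}·β^p·D^{2p−1}). -/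
open MeasureTheory ProbabilityTheory
open scoped RealInnerProductSpace

/-- An odd function whose derivative is at least `c p |x|^(p-1)` near `0` increases by at least
`2 c t^p` across any interval of length at least `2 t`. -/
lemma two_mul_pow_le_sub_of_deriv_ge {ρ ρd : ℝ → ℝ} {r c : ℝ} {p : ℕ} (hp : 1 ≤ p) (hc : 0 < c)
    (hρdiff : ∀ x, HasDerivAt ρ (ρd x) x) (hρanti : ∀ x, ρ (-x) = -ρ x) (hρ0 : ρ 0 = 0)
    (hρlb : ∀ x ∈ Set.Ioo (-r) r, c * p * |x| ^ (p - 1) ≤ ρd x)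
    {x y t : ℝ} (hx : |x| ≤ r) (hy : |y| ≤ r) (ht : 0 ≤ t) (hxy : 2 * t ≤ y - x) :
    2 * (c * t ^ p) ≤ ρ y - ρ x := by
  have hmono : MonotoneOn (fun z => ρ z - c * z ^ p) (Set.Icc 0 r) := by
    have hder : ∀ z, HasDerivAt (fun z => ρ z - c * z ^ p)
        (ρd z - c * (p * z ^ (p - 1))) z := fun z =>
      (hρdiff z).sub ((hasDerivAt_pow p z).const_mul c)
    refine monotoneOn_of_deriv_nonneg (convex_Icc 0 r)
      (fun z _ => (hder z).continuousAt.continuousWithinAt)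
      (fun z _ => (hder z).differentiableAt.differentiableWithinAt) fun z hz => ?_
    rw [interior_Icc] at hz
    have h := hρlb z ⟨by linarith [hz.1, hz.2], hz.2⟩
    rw [abs_of_pos hz.1] at h
    rw [(hder z).deriv]
    linarith
  have key : ∀ a b, 0 ≤ a → a ≤ b → b ≤ r → c * (b ^ p - a ^ p) ≤ ρ b - ρ a := by
    intro a b ha hab hb
    have := hmono ⟨ha, hab.trans hb⟩ ⟨ha.trans hab, hb⟩ hab
    simp only at this
    linarith
  have hsup : ∀ a b, 0 ≤ a → 2 * t ≤ b - a → 2 * t ^ p ≤ b ^ p - a ^ p := by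
    intro a b ha hab
    have h1 : (a + 2 * t) ^ p ≤ b ^ p := pow_le_pow_left₀ (by positivity) (by linarith) p
    have h2 : a ^ p + (2 * t) ^ p ≤ (a + 2 * t) ^ p :=
      pow_add_pow_le ha (by positivity) (by omega)
    have h3 : 2 * t ^ p ≤ (2 * t) ^ p := by
      rw [mul_pow]
      gcongr
      exact le_self_pow₀ (by norm_num) (by omega)
    linarith
  have hx' := abs_le.mp hx
  have hy' := abs_le.mp hy
  rcases le_total 0 x with h0x | h0x
  · have h1 := key x y h0x (by linarith) hy'.2
    have h2 := mul_le_mul_of_nonneg_left (hsup x y h0x hxy) hc.le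
    linarith
  · rcases le_total 0 y with h0y | h0y
    · have h1 := key 0 y le_rfl h0y hy'.2
      have h2 := key 0 (-x) le_rfl (by linarith) (by linarith)
      rw [hρanti, hρ0, zero_pow (by omega)] at h2
      rw [hρ0, zero_pow (by omega)] at h1
      have h3 : (2 * t) ^ p ≤ (y + -x) ^ p := pow_le_pow_left₀ (by positivity) (by linarith) p
      have h4 := add_pow_le h0y (neg_nonneg.mpr h0x) p
      obtain ⟨q, rfl⟩ : ∃ q, p = q + 1 := ⟨p - 1, by omega⟩
      have h5 : 2 * t ^ (q + 1) ≤ y ^ (q + 1) + (-x) ^ (q + 1) := by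
        have h6 : (2 : ℝ) ^ q * (2 * t ^ (q + 1)) ≤
            2 ^ q * (y ^ (q + 1) + (-x) ^ (q + 1)) := by
          have : (2 * t) ^ (q + 1) = (2 : ℝ) ^ q * (2 * t ^ (q + 1)) := by ring
          rw [← this]
          exact h3.trans h4
        exact le_of_mul_le_mul_left h6 (by positivity)
      have h2 := mul_le_mul_of_nonneg_left h5 hc.le
      linarith
    · have h1 := key (-y) (-x) (by linarith) (by linarith) (by linarith)
      rw [hρanti, hρanti] at h1
      have h2 := mul_le_mul_of_nonneg_left (hsup (-y) (-x) (by linarith) (by linarith)) hc.le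
      linarith

/-- Gradients of a smooth convex function change by at most `2 β γ` within distance `γ`. -/
lemma inner_gradient_ge_sub {E : Type*} [NormedAddCommGroup E] [InnerProductSpace ℝ E]
    {f : E → ℝ} {gradf : E → E} {β γ : ℝ} (hβ : 0 ≤ β) (hγ : 0 < γ)
    (hconvf : ∀ x y, ⟪gradf x, y - x⟫ ≤ f y - f x)
    (hsmooth : ∀ x y, f y ≤ f x + ⟪gradf x, y - x⟫ + β / 2 * ‖y - x‖ ^ 2)
    {w z v : E} (hz : ‖z - w‖ ≤ γ) (hv : v ≠ 0) :
    ⟪gradf w, v⟫ - 2 * β * γ * ‖v‖ ≤ ⟪gradf z, v⟫ := by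
  have hv0 : 0 < ‖v‖ := norm_pos_iff.mpr hv
  set t := γ / ‖v‖ with ht
  have htpos : 0 < t := by positivity
  have h1 := hconvf z (z - t • v)
  have h2 := hsmooth w (z - t • v)
  have h3 := hconvf w z
  have h4 : ‖z - t • v - w‖ ≤ 2 * γ := by
    have e : z - t • v - w = (z - w) - t • v := by abel
    rw [e]
    refine (norm_sub_le _ _).trans ?_
    rw [norm_smul, Real.norm_of_nonneg htpos.le, ht, div_mul_cancel₀ _ hv0.ne']
    linarith
  have h5 : ‖z - t • v - w‖ ^ 2 ≤ (2 * γ) ^ 2 := pow_le_pow_left₀ (norm_nonneg _) h4 2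
  have e1 : z - t • v - z = -(t • v) := by abel
  have e2 : z - t • v - w = (z - w) - t • v := by abel
  rw [e1, inner_neg_right, inner_smul_right] at h1
  rw [e2, inner_sub_right, inner_smul_right, ← e2] at h2
  have h6 : t * (⟪gradf w, v⟫ - ⟪gradf z, v⟫) ≤ t * (2 * β * γ * ‖v‖) := by
    have : t * (2 * β * γ * ‖v‖) = 2 * β * γ ^ 2 := by rw [ht]; field_simp
    rw [this]
    nlinarith [mul_le_mul_of_nonneg_left h5 hβ]
  linarith [le_of_mul_le_mul_left h6 htpos]

/-- Second moment of a rotation-invariant law on the unit sphere. -/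
lemma integral_inner_sq_of_rotation_invariant {d : ℕ} (hd : 0 < d)
    (μ : Measure (EuclideanSpace ℝ (Fin d))) [IsProbabilityMeasure μ]
    (hsph : ∀ᵐ x ∂μ, ‖x‖ = 1)
    (hrot : ∀ T : EuclideanSpace ℝ (Fin d) ≃ₗᵢ[ℝ] EuclideanSpace ℝ (Fin d),
      Measure.map (⇑T) μ = μ) (v : EuclideanSpace ℝ (Fin d)) :
    ∫ x, ⟪x, v⟫ ^ 2 ∂μ = ‖v‖ ^ 2 / d := by
  have hint : ∀ y : EuclideanSpace ℝ (Fin d), Integrable (fun x => ⟪x, y⟫ ^ 2) μ := by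
    intro y
    refine Integrable.of_bound (by fun_prop) (‖y‖ ^ 2) ?_
    filter_upwards [hsph] with x hx
    rw [norm_pow]
    refine pow_le_pow_left₀ (norm_nonneg _) ?_ 2
    simpa [hx] using norm_inner_le_norm (𝕜 := ℝ) x y
  have hsymm : ∀ y z : EuclideanSpace ℝ (Fin d), ‖y‖ = ‖z‖ →
      ∫ x, ⟪x, y⟫ ^ 2 ∂μ = ∫ x, ⟪x, z⟫ ^ 2 ∂μ := by
    intro y z hyz
    let T := (ℝ ∙ (y - z))ᗮ.reflection
    have hT : T y = z := Submodule.reflection_sub hyz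
    conv_rhs => rw [← hrot T]
    rw [integral_map T.continuous.measurable.aemeasurable (by fun_prop)]
    refine integral_congr_ae (.of_forall fun x => ?_)
    simp only
    rw [← hT, LinearIsometryEquiv.inner_map_map]
  have hsum : ∑ i : Fin d, ∫ x, ⟪x, ‖v‖ • EuclideanSpace.basisFun (Fin d) ℝ i⟫ ^ 2 ∂μ =
      ‖v‖ ^ 2 := by
    rw [← integral_finsetSum _ fun i _ => hint _]
    have : (fun x => ∑ i : Fin d, ⟪x, ‖v‖ • EuclideanSpace.basisFun (Fin d) ℝ i⟫ ^ 2) =ᵐ[μ]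
        fun _ => ‖v‖ ^ 2 := by
      filter_upwards [hsph] with x hx
      simp_rw [inner_smul_right, mul_pow]
      rw [← Finset.mul_sum]
      have := (EuclideanSpace.basisFun (Fin d) ℝ).sum_sq_norm_inner_left x
      simp only [Real.norm_eq_abs, sq_abs, hx, one_pow] at this
      rw [this, mul_one]
    rw [integral_congr_ae this]
    simp
  have hd' : (d : ℝ) ≠ 0 := by positivity
  rw [Finset.sum_congr rfl fun i _ => (hsymm _ v (by simp [norm_smul]))] at hsum
  rw [← hsum]
  simp
  field_simp

/-- Power-mean inequality against the second moment. -/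
lemma pow_le_integral_abs_pow {α : Type*} [MeasurableSpace α] (μ : Measure α)
    [IsProbabilityMeasure μ] {g : α → ℝ} {s : ℝ} {n : ℕ} (hn : 2 ≤ n) (hs : 0 ≤ s)
    (hg2 : Integrable (fun x => g x ^ 2) μ) (hgn : Integrable (fun x => |g x| ^ n) μ)
    (h : ∫ x, g x ^ 2 ∂μ = s ^ 2) : s ^ n ≤ ∫ x, |g x| ^ n ∂μ := by
  have hpow : ∀ a : ℝ, (a ^ 2) ^ ((n : ℝ) / 2) = |a| ^ n := by
    intro a
    rw [← sq_abs, ← Real.rpow_natCast |a| 2, ← Real.rpow_mul (abs_nonneg a),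
      ← Real.rpow_natCast |a| n]
    congr 1
    push_cast
    ring
  have hn' : (1 : ℝ) ≤ (n : ℝ) / 2 := by
    have : (2 : ℝ) ≤ n := by exact_mod_cast hn
    linarith
  have hJ := (convexOn_rpow hn').map_integral_le (μ := μ) (f := fun x => g x ^ 2)
    (continuousOn_id.rpow_const fun _ _ => Or.inr (by linarith)) isClosed_Ici
    (.of_forall fun x => sq_nonneg (g x)) hg2
    (by simpa only [Function.comp_def, hpow] using hgn)
  simp only [h, hpow, abs_of_nonneg hs] at hJ
  exact hJ

/-- A lower bound on directional derivatives along `v` passes to central differences. -/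
lemma two_mul_le_central_difference_sub {E : Type*} [NormedAddCommGroup E]
    [InnerProductSpace ℝ E] {f : E → ℝ} {gradf : E → E} {γ m s : ℝ} (hγ : 0 < γ) (hs : 0 ≤ s)
    (hconvf : ∀ x y, ⟪gradf x, y - x⟫ ≤ f y - f x) {w v x y : E}
    (hgrad : ∀ z, ‖z - w‖ ≤ γ → m ≤ ⟪gradf z, v⟫)
    (hx : ‖x‖ ≤ 1) (hy : ‖y‖ ≤ 1) (hxy : x - y = s • v) :
    2 * (γ * s * m) ≤ (f (w + γ • x) - f (w - γ • x)) - (f (w + γ • y) - f (w - γ • y)) := by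
  have hstep : ∀ z z', ‖z - w‖ ≤ γ → z' - z = (γ * s) • v → γ * s * m ≤ f z' - f z := by
    intro z z' hz hzz'
    refine le_trans ?_ (hconvf z z')
    rw [hzz', inner_smul_right]
    exact mul_le_mul_of_nonneg_left (hgrad z hz) (by positivity)
  have hnorm : ∀ a : E, ‖a‖ ≤ 1 → ‖γ • a‖ ≤ γ := by
    intro a ha
    rw [norm_smul, Real.norm_of_nonneg hγ.le]
    exact mul_le_of_le_one_right hγ.le ha
  have h1 := hstep (w + γ • y) (w + γ • x) (by simpa using hnorm y hy)
    (by rw [mul_smul, ← hxy, smul_sub]; abel)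
  have h2 := hstep (w - γ • x) (w - γ • y) (by simpa using hnorm x hx)
    (by rw [mul_smul, ← hxy, smul_sub]; abel)
  linarith

/-- Correlation of a bounded function with a linear functional, under a rotation-invariant law on
the sphere, bounded below through its increments under reflection along `v`. -/
lemma mul_pow_le_integral_mul_inner {d n : ℕ} (hd : 0 < d) (hn : 1 ≤ n)
    (μ : Measure (EuclideanSpace ℝ (Fin d))) [IsProbabilityMeasure μ]
    (hsph : ∀ᵐ x ∂μ, ‖x‖ = 1)
    (hrot : ∀ T : EuclideanSpace ℝ (Fin d) ≃ₗᵢ[ℝ] EuclideanSpace ℝ (Fin d),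
      Measure.map (⇑T) μ = μ) (v : EuclideanSpace ℝ (Fin d))
    {h : EuclideanSpace ℝ (Fin d) → ℝ} (hmeas : Measurable h) (hbound : ∀ x, |h x| ≤ 1)
    {A : ℝ} (hA : 0 ≤ A)
    (hincr : ∀ x, ‖x‖ = 1 → 0 ≤ ⟪x, v⟫ →
      2 * (A * ⟪x, v⟫ ^ n) ≤ h x - h ((ℝ ∙ v)ᗮ.reflection x)) :
    A * (‖v‖ / Real.sqrt d) ^ (n + 1) ≤ ∫ x, h x * ⟪x, v⟫ ∂μ := by
  let T := (ℝ ∙ v)ᗮ.reflection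
  have hTv : ∀ x, ⟪T x, v⟫ = -⟪x, v⟫ := by
    intro x
    have : v = T (-v) := by
      rw [map_neg, Submodule.reflection_orthogonalComplement_singleton_eq_neg, neg_neg]
    conv_lhs => rw [this]
    rw [LinearIsometryEquiv.inner_map_map, inner_neg_right]
  have hTT : ∀ x, T (T x) = x := fun x => Submodule.reflection_reflection _ x
  have hTmeas : Measurable T := T.continuous.measurable
  have hinner : ∀ x : EuclideanSpace ℝ (Fin d), ‖x‖ = 1 → |⟪x, v⟫| ≤ ‖v‖ := by
    intro x hx
    simpa [hx] using norm_inner_le_norm (𝕜 := ℝ) x v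
  have hint : ∀ g : EuclideanSpace ℝ (Fin d) → ℝ, Measurable g → (∀ x, |g x| ≤ 1) →
      Integrable (fun x => g x * ⟪x, v⟫) μ := by
    intro g hg hg1
    refine Integrable.of_bound (by fun_prop) ‖v‖ ?_
    filter_upwards [hsph] with x hx
    rw [norm_mul, Real.norm_eq_abs, Real.norm_eq_abs]
    exact (mul_le_of_le_one_left (abs_nonneg _) (hg1 x)).trans (hinner x hx)
  have hintpow : ∀ k : ℕ, Integrable (fun x => |⟪x, v⟫| ^ k) μ := by
    intro k
    refine Integrable.of_bound (by fun_prop) (‖v‖ ^ k) ?_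
    filter_upwards [hsph] with x hx
    rw [norm_pow, Real.norm_eq_abs, abs_abs]
    exact pow_le_pow_left₀ (abs_nonneg _) (hinner x hx) k
  have hrefl : ∫ x, h x * ⟪x, v⟫ ∂μ = -∫ x, h (T x) * ⟪x, v⟫ ∂μ := by
    conv_lhs => rw [← hrot T]
    rw [integral_map hTmeas.aemeasurable (by fun_prop), ← integral_neg]
    simp only [hTv, mul_neg]
  have hpt : ∀ x, ‖x‖ = 1 →
      2 * (A * |⟪x, v⟫| ^ (n + 1)) ≤ h x * ⟪x, v⟫ - h (T x) * ⟪x, v⟫ := by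
    intro x hx
    rcases le_total 0 ⟪x, v⟫ with hb | hb
    · rw [abs_of_nonneg hb]
      have := mul_le_mul_of_nonneg_right (hincr x hx hb) hb
      calc _ = 2 * (A * ⟪x, v⟫ ^ n) * ⟪x, v⟫ := by ring
        _ ≤ _ := this
        _ = _ := by ring
    · rw [abs_of_nonpos hb]
      have hb' : 0 ≤ ⟪T x, v⟫ := by rw [hTv]; linarith
      have h1 := hincr (T x) (by rw [T.norm_map, hx]) hb'
      have := mul_le_mul_of_nonneg_right h1 hb'
      change _ ≤ (h (T x) - h (T (T x))) * _ at this
      rw [hTT, hTv] at this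
      calc _ = 2 * (A * (-⟪x, v⟫) ^ n) * -⟪x, v⟫ := by ring
        _ ≤ _ := this
        _ = _ := by ring
  have hmean : 2 * (A * ∫ x, |⟪x, v⟫| ^ (n + 1) ∂μ) ≤ 2 * ∫ x, h x * ⟪x, v⟫ ∂μ := by
    have h1 := hint h hmeas hbound
    have h2 := hint (fun x => h (T x)) (hmeas.comp hTmeas) fun x => hbound _
    calc _ = ∫ x, 2 * (A * |⟪x, v⟫| ^ (n + 1)) ∂μ := by
          rw [integral_const_mul, integral_const_mul]
      _ ≤ ∫ x, (h x * ⟪x, v⟫ - h (T x) * ⟪x, v⟫) ∂μ := by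
          refine integral_mono_ae (((hintpow _).const_mul A).const_mul 2) (h1.sub h2) ?_
          filter_upwards [hsph] with x hx using hpt x hx
      _ = _ := by rw [integral_sub h1 h2, hrefl]; linarith
  have hpow := pow_le_integral_abs_pow μ (g := fun x => ⟪x, v⟫) (n := n + 1)
    (s := ‖v‖ / Real.sqrt d) (by omega) (by positivity) (by simpa using hintpow 2) (hintpow _)
    (by rw [integral_inner_sq_of_rotation_invariant hd μ hsph hrot, div_pow,
      Real.sq_sqrt (by positivity)])
  linarith [mul_le_mul_of_nonneg_left hpow hA]

/-- Pulling a conditional mean given `u` through the correlation with `u`. -/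
lemma inner_integral_smul_eq_of_condExp {E Ω : Type*} [NormedAddCommGroup E]
    [InnerProductSpace ℝ E] [CompleteSpace E] [MeasurableSpace E] [BorelSpace E]
    [SecondCountableTopology E] [MeasurableSpace Ω] (P : Measure Ω) [IsProbabilityMeasure P]
    {u : Ω → E} (hu : Measurable u) (husph : ∀ᵐ ω ∂P, ‖u ω‖ = 1)
    {o : Ω → ℝ} (ho : Measurable o) (hobound : ∀ ω, |o ω| ≤ 1) {h : E → ℝ} (hh : Measurable h)
    (hcond : P[o | MeasurableSpace.comap u inferInstance] =ᵐ[P] fun ω => h (u ω)) (v : E) :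
    ⟪∫ ω, o ω • u ω ∂P, v⟫ = ∫ x, h x * ⟪x, v⟫ ∂(Measure.map u P) := by
  have hou : Integrable (fun ω => o ω • u ω) P := by
    refine Integrable.of_bound (by fun_prop) 1 ?_
    filter_upwards [husph] with ω hω
    simpa [norm_smul, hω] using hobound ω
  have hoint : Integrable o P :=
    Integrable.of_bound (by fun_prop) 1 (.of_forall hobound)
  have hprod : Integrable (o * fun ω => ⟪u ω, v⟫) P := by
    refine (hou.inner_const (𝕜 := ℝ) v).congr (.of_forall fun ω => ?_)
    simp [real_inner_smul_left]
  have hcomap : MeasurableSpace.comap u inferInstance ≤ (inferInstance : MeasurableSpace Ω) :=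
    hu.comap_le
  have hsm : StronglyMeasurable[MeasurableSpace.comap u inferInstance] fun ω => ⟪u ω, v⟫ := by
    have : Measurable fun x : E => ⟪x, v⟫ := by fun_prop
    exact (this.comp (comap_measurable u)).stronglyMeasurable
  have hpull := condExp_mul_of_stronglyMeasurable_right hsm hprod hoint
  rw [real_inner_comm, ← integral_inner hou v, integral_map hu.aemeasurable (by fun_prop)]
  calc ∫ ω, ⟪v, o ω • u ω⟫ ∂P = ∫ ω, (o * fun ω => ⟪u ω, v⟫) ω ∂P := by
        refine integral_congr_ae (.of_forall fun ω => ?_)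
        simp [real_inner_smul_right, real_inner_comm]
    _ = ∫ ω, (P[o * fun ω => ⟪u ω, v⟫ | MeasurableSpace.comap u inferInstance]) ω ∂P :=
        (integral_condExp hcomap).symm
    _ = ∫ ω, h (u ω) * ⟪u ω, v⟫ ∂P := by
        refine integral_congr_ae ?_
        filter_upwards [hpull, hcond] with ω h1 h2
        rw [h1, Pi.mul_apply, h2]



/-- Descent-direction lower bound, eq. lb4: Under the general transfer
function assumptions with minimal degree `p ≥ 1`, for `w ∈ 𝒟` with suboptimality gap
more than `ε`, `c̃ = 1/20`, `γ = c̃ε/(β√d·D)` with `2Lγ ≤ r`, `u` uniform on the unit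
sphere and `o ∈ {±1}` with `E[o | u] = ρ(f(w+γu) − f(w−γu))`:
`⟨E[o·u], w − w*⟩ ≥ p·c_ρ·c̃^{2p−1}·ε^{2p} / (d^{(2p+1)/2}·β^p·D^{2p−1})`. -/
theorem stmt10 (d p : ℕ) (hd : 0 < d) (hp : 1 ≤ p)
    (β L r cρ ε D : ℝ)
    (hβ : 0 < β) (hL : 0 < L) (hr : 0 < r) (hcρ : 0 < cρ) (hε : 0 < ε) (hD : 0 < D)
    (𝒟 : Set (EuclideanSpace ℝ (Fin d))) (hconv : Convex ℝ 𝒟)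
    (hbdd : Bornology.IsBounded 𝒟) (hdiam : Metric.diam 𝒟 = D)
    (f : EuclideanSpace ℝ (Fin d) → ℝ)
    (gradf : EuclideanSpace ℝ (Fin d) → EuclideanSpace ℝ (Fin d))
    (hdiff : ∀ x, HasGradientAt f (gradf x) x)
    (hconvf : ∀ x y, ⟪gradf x, y - x⟫ ≤ f y - f x)
    (hLip : ∀ x y, |f x - f y| ≤ L * ‖x - y‖)
    (hsmooth : ∀ x y, f y ≤ f x + ⟪gradf x, y - x⟫ + β / 2 * ‖y - x‖ ^ 2)
    (wstar : EuclideanSpace ℝ (Fin d)) (hws : wstar ∈ 𝒟)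
    (hmin : ∀ v ∈ 𝒟, f wstar ≤ f v)
    (ρ ρd : ℝ → ℝ)
    (hρrange : ∀ x, ρ x ∈ Set.Icc (-1 : ℝ) 1)
    (hρdiff : ∀ x, HasDerivAt ρ (ρd x) x)
    (hρanti : ∀ x, ρ (-x) = -ρ x)
    (hρ0 : ρ 0 = 0)
    (hρsign : ∀ x : ℝ, x ≠ 0 → Real.sign (ρ x) = Real.sign x)
    (hρlb : ∀ x ∈ Set.Ioo (-r) r, cρ * p * |x| ^ (p - 1) ≤ ρd x)
    (w : EuclideanSpace ℝ (Fin d)) (hw : w ∈ 𝒟) (hgap : ε < f w - f wstar)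
    (γ : ℝ) (hγdef : γ = (1 / 20) * ε / (β * Real.sqrt d * D)) (hγr : 2 * L * γ ≤ r)
    (μ : Measure (EuclideanSpace ℝ (Fin d))) [IsProbabilityMeasure μ]
    (hsph : ∀ᵐ x ∂μ, ‖x‖ = 1)
    (hrot : ∀ T : EuclideanSpace ℝ (Fin d) ≃ₗᵢ[ℝ] EuclideanSpace ℝ (Fin d),
      Measure.map (⇑T) μ = μ)
    (Ω : Type) [MeasurableSpace Ω] (P : Measure Ω) [IsProbabilityMeasure P]
    (u : Ω → EuclideanSpace ℝ (Fin d)) (hu : Measurable u)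
    (hulaw : Measure.map u P = μ)
    (o : Ω → ℝ) (ho : Measurable o) (hosign : ∀ ω, o ω = 1 ∨ o ω = -1)
    (hcond : P[o | MeasurableSpace.comap u inferInstance] =ᵐ[P]
      fun ω => ρ (f (w + γ • u ω) - f (w - γ • u ω))) :
    (p : ℝ) * cρ * (1 / 20 : ℝ) ^ (2 * p - 1) * ε ^ (2 * p) /
        ((d : ℝ) ^ ((2 * (p : ℝ) + 1) / 2) * β ^ p * D ^ (2 * p - 1)) ≤
      ⟪∫ ω, o ω • u ω ∂P, w - wstar⟫ := by
  set v := w - wstar with hv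
  set s := Real.sqrt d with hs
  have hd1 : (1 : ℝ) ≤ d := by exact_mod_cast hd
  have hs1 : 1 ≤ s := Real.one_le_sqrt.mpr hd1
  have hs0 : 0 < s := by linarith
  have hγ : 0 < γ := by rw [hγdef]; positivity
  have hv0 : v ≠ 0 := by
    intro h
    rw [hv, sub_eq_zero] at h
    rw [h] at hgap
    linarith
  have hvpos : 0 < ‖v‖ := norm_pos_iff.mpr hv0
  have hvD : ‖v‖ ≤ D := by
    rw [hv, ← dist_eq_norm, ← hdiam]
    exact Metric.dist_le_diam_of_mem hbdd hw hws
  have hgv : ε ≤ ⟪gradf w, v⟫ := by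
    have h1 := hconvf w wstar
    have h2 : wstar - w = -v := by rw [hv]; abel
    rw [h2, inner_neg_right] at h1
    linarith
  have hγε : 2 * β * γ * ‖v‖ ≤ ε / 2 := by
    have h1 : 2 * β * γ * D = ε / 10 / s := by rw [hγdef]; field_simp; norm_num
    have h2 : ε / 10 / s ≤ ε / 10 := div_le_self (by positivity) hs1
    have h3 : 2 * β * γ * ‖v‖ ≤ 2 * β * γ * D := by gcongr
    linarith
  have hgrad : ∀ z, ‖z - w‖ ≤ γ → ε / 2 ≤ ⟪gradf z, v⟫ := by
    intro z hz
    linarith [inner_gradient_ge_sub hβ.le hγ hconvf hsmooth hz hv0]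
  have hF : ∀ x : EuclideanSpace ℝ (Fin d), ‖x‖ = 1 →
      |f (w + γ • x) - f (w - γ • x)| ≤ r := by
    intro x hx
    refine (hLip _ _).trans (le_trans (le_of_eq ?_) hγr)
    have : w + γ • x - (w - γ • x) = (2 * γ) • x := by rw [mul_smul, two_smul]; abel
    rw [this, norm_smul, hx, Real.norm_of_nonneg (by positivity)]
    ring
  have hfcont : Continuous f :=
    continuous_iff_continuousAt.mpr fun x => (hdiff x).continuousAt
  have hρcont : Continuous ρ :=
    continuous_iff_continuousAt.mpr fun x => (hρdiff x).continuousAt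
  have hmeas : Measurable fun x => ρ (f (w + γ • x) - f (w - γ • x)) :=
    Continuous.measurable (by fun_prop)
  have hincr : ∀ x : EuclideanSpace ℝ (Fin d), ‖x‖ = 1 → 0 ≤ ⟪x, v⟫ →
      2 * (cρ * (γ * ε / ‖v‖ ^ 2) ^ p * ⟪x, v⟫ ^ p) ≤
        (fun x => ρ (f (w + γ • x) - f (w - γ • x))) x -
        (fun x => ρ (f (w + γ • x) - f (w - γ • x))) ((ℝ ∙ v)ᗮ.reflection x) := by
    intro x hx hb
    have hx' : ‖(ℝ ∙ v)ᗮ.reflection x‖ = 1 := by rw [LinearIsometryEquiv.norm_map, hx]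
    have hdiff' : x - (ℝ ∙ v)ᗮ.reflection x = (2 * (⟪x, v⟫ / ‖v‖ ^ 2)) • v := by
      rw [Submodule.reflection_orthogonal_apply, Submodule.reflection_singleton_apply,
        real_inner_comm, mul_smul, two_smul, two_smul]
      simp
    have h1 := two_mul_le_central_difference_sub hγ (by positivity) hconvf hgrad hx.le hx'.le hdiff'
    rw [mul_assoc, ← mul_pow]
    refine two_mul_pow_le_sub_of_deriv_ge hp hcρ hρdiff hρanti hρ0 hρlb (hF _ hx') (hF _ hx)
      (by positivity) (le_trans (le_of_eq ?_) h1)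
    ring
  have hsphP : ∀ᵐ ω ∂P, ‖u ω‖ = 1 := by
    rw [← hulaw] at hsph
    exact ae_of_ae_map hu.aemeasurable hsph
  rw [inner_integral_smul_eq_of_condExp P hu hsphP ho
    (fun ω => by rcases hosign ω with h | h <;> simp [h]) hmeas hcond v, hulaw]
  refine le_trans ?_ (mul_pow_le_integral_mul_inner hd hp μ hsph hrot v hmeas
    (fun x => abs_le.mpr (hρrange _)) (by positivity) hincr)
  have hdpow : (d : ℝ) ^ ((2 * (p : ℝ) + 1) / 2) = s ^ (2 * p + 1) := by
    rw [hs, Real.sqrt_eq_rpow, ← Real.rpow_natCast, ← Real.rpow_mul (by positivity)]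
    congr 1
    push_cast
    ring
  rw [hdpow]
  obtain ⟨q, rfl⟩ : ∃ q, p = q + 1 := ⟨p - 1, by omega⟩
  have hq : ((q + 1 : ℕ) : ℝ) * (1 / 20) ^ q ≤ 1 := by
    have h1 : ((q + 1 : ℕ) : ℝ) ≤ 20 ^ q := by
      exact_mod_cast Nat.succ_le_of_lt (Nat.lt_pow_self (by norm_num))
    rw [one_div, inv_pow, ← div_eq_mul_inv, div_le_one (by positivity)]
    exact h1
  calc _ = ((q + 1 : ℕ) : ℝ) * (1 / 20) ^ q * (cρ * (γ * ε) ^ (q + 1) / (s ^ (q + 2) * D ^ q)) := by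
        rw [hγdef, show 2 * (q + 1) - 1 = 2 * q + 1 by omega]
        simp only [mul_pow, div_pow, one_pow]
        field_simp
        ring
    _ ≤ 1 * (cρ * (γ * ε) ^ (q + 1) / (s ^ (q + 2) * ‖v‖ ^ q)) := by gcongr
    _ = _ := by
        rw [← hs, div_pow, div_pow]
        field_simp
        ring
end

section
/- (Roundwise progress of Relative-Gradient-Descent.) Let 𝒟 ⊆ ℝ^d be convex, closed and bounded with Euclidean diameter D, let f : 𝒟 → ℝ be convex, β-smooth and L-Lipschitz, and let w* be a minimizer of f over 𝒟. Let ρ : ℝ → [−1, 1] be differentiable, anti-symmetric, with ρ(0) = 0, sign(ρ(x)) = sign(x) for x ≠ 0, and such that there are constants p ≥ 1 and r, c_ρ > 0 with ρ'(x) ≥ c_ρ·p·|x|^{p−1} for all x ∈ (−r, r). Set c̃ = 1/20, γ = c̃ε/(β√d·D), η = p·c_ρ·c̃^{2p−1}·ε^{2p}/(d^{(2p+1)/2}·β^p·D^{2p−1}), and assume 2Lγ ≤ r. Suppose w_t ∈ 𝒟 satisfies f(w_t) − f(w*) > ε. Let u be uniform on the unit sphere S^{d−1}, let o ∈ {±1}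 be a random sign with E[o | u] = ρ(f(w_t + γu) − f(w_t − γu)), and define w_{t+1} := Π_𝒟(w_t − η·o·u), where Π_𝒟 is the Euclidean projection onto 𝒟. Then E[‖w_{t+1} − w*‖²] ≤ ‖w_t − w*‖² − p²·(c̃^{2p−1}·c_ρ)²·ε^{4p} / (d^{2p+1}·β^{2p}·D^{4p−2}). -/
open MeasureTheory ProbabilityTheory
open scoped RealInnerProductSpace

section Inner

variable {E : Type*} [NormedAddCommGroup E] [InnerProductSpace ℝ E]

/-- A convex function satisfying the quadratic upper bound with constant `β` has a `β`-Lipschitz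
gradient. -/
theorem norm_gradient_sub_le {f : E → ℝ} {g : E → E} {β : ℝ} (hβ : 0 < β)
    (hconv : ∀ x y, ⟪g x, y - x⟫ ≤ f y - f x)
    (hsmooth : ∀ x y, f y ≤ f x + ⟪g x, y - x⟫ + β / 2 * ‖y - x‖ ^ 2) (x y : E) :
    ‖g x - g y‖ ≤ β * ‖x - y‖ := by
  set h := g x - g y with hh
  have h1 := hconv y (x - β⁻¹ • h)
  have h2 := hsmooth x (x - β⁻¹ • h)
  have h3 := hsmooth y x
  have e1 : x - β⁻¹ • h - x = -(β⁻¹ • h) := by abel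
  have e2 : x - β⁻¹ • h - y = (x - y) - β⁻¹ • h := by abel
  have e3 : ⟪g x, h⟫ - ⟪g y, h⟫ = ‖h‖ ^ 2 := by
    rw [← inner_sub_left, ← hh, real_inner_self_eq_norm_sq]
  rw [e1, norm_neg, norm_smul, inner_neg_right, real_inner_smul_right, Real.norm_eq_abs, mul_pow,
    sq_abs] at h2
  rw [e2, inner_sub_right, real_inner_smul_right] at h1
  have h4 : β⁻¹ * ‖h‖ ^ 2 ≤ β / 2 * ‖x - y‖ ^ 2 + β⁻¹ / 2 * ‖h‖ ^ 2 := by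
    have : β / 2 * (β⁻¹ ^ 2 * ‖h‖ ^ 2) = β⁻¹ / 2 * ‖h‖ ^ 2 := by field_simp
    rw [this] at h2
    rw [← e3] at h2 ⊢
    linarith
  refine abs_le_of_sq_le_sq' ?_ (by positivity) |>.2
  have h5 : ‖h‖ ^ 2 = β * (2 * (β⁻¹ / 2 * ‖h‖ ^ 2)) := by field_simp
  rw [h5]
  have h6 : β⁻¹ / 2 * ‖h‖ ^ 2 ≤ β / 2 * ‖x - y‖ ^ 2 := by linarith
  nlinarith

/-- Passing from `z` to a nearest point of a convex set `K` does not increase the distance to any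
point of `K`. -/
theorem norm_nearest_sub_le {K : Set E} (hK : Convex ℝ K) {z q y : E} (hq : q ∈ K)
    (hmin : ∀ x ∈ K, ‖q - z‖ ≤ ‖x - z‖) (hy : y ∈ K) : ‖q - y‖ ≤ ‖z - y‖ := by
  have : Nonempty K := ⟨⟨q, hq⟩⟩
  have hinf : ‖z - q‖ = ⨅ w : K, ‖z - w‖ := by
    refine le_antisymm (le_ciInf fun w => ?_)
      (ciInf_le ⟨0, by rintro _ ⟨w, rfl⟩; positivity⟩ (⟨q, hq⟩ : K))
    rw [norm_sub_rev z q, norm_sub_rev z w]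
    exact hmin w w.2
  have h := (norm_eq_iInf_iff_real_inner_le_zero hK hq).1 hinf y hy
  refine abs_le_of_sq_le_sq' ?_ (norm_nonneg _) |>.2
  have e : z - y = (z - q) - (y - q) := by abel
  rw [e, norm_sub_rev q y, norm_sub_sq_real (z - q)]
  nlinarith [sq_nonneg ‖z - q‖]

theorem reflection_orthogonal_singleton_apply (v u : E) :
    (ℝ ∙ v)ᗮ.reflection u = u - (2 * ⟪u, v⟫ / ‖v‖ ^ 2) • v := by
  rw [Submodule.reflection_orthogonal_apply, Submodule.reflection_singleton_apply, neg_sub,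
    real_inner_comm, ← Nat.cast_smul_eq_nsmul ℝ, smul_smul]
  simp [mul_div_assoc]

end Inner

/-- An odd function whose derivative dominates that of `c * x ^ p` on `(0, r)` grows at least like
the odd extension of `c * x ^ p`, whose increments over length `h` are at least `2 c (h / 2) ^ p`. -/
theorem odd_increment_lower_bound {ρ ρd : ℝ → ℝ} {c r : ℝ} {p : ℕ} (hp : 1 ≤ p) (hc : 0 < c)
    (hdiff : ∀ x, HasDerivAt ρ (ρd x) x) (hanti : ∀ x, ρ (-x) = -ρ x) (hρ0 : ρ 0 = 0)
    (hlb : ∀ x ∈ Set.Ioo (-r) r, c * p * |x| ^ (p - 1) ≤ ρd x)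
    {s t : ℝ} (hts : t ≤ s) (hs : |s| ≤ r) (ht : |t| ≤ r) :
    2 * c * ((s - t) / 2) ^ p ≤ ρ s - ρ t := by
  obtain ⟨q, rfl⟩ : ∃ q, p = q + 1 := ⟨p - 1, by omega⟩
  have hmono : MonotoneOn (fun x => ρ x - c * x ^ (q + 1)) (Set.Icc 0 r) := by
    have hd : ∀ x, HasDerivAt (fun x => ρ x - c * x ^ (q + 1))
        (ρd x - c * (((q + 1 : ℕ) : ℝ) * x ^ q)) x := fun x =>
      (hdiff x).sub ((hasDerivAt_pow (q + 1) x).const_mul c)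
    refine monotoneOn_of_deriv_nonneg (convex_Icc _ _)
      (fun x _ => (hd x).continuousAt.continuousWithinAt)
      (fun x _ => (hd x).differentiableAt.differentiableWithinAt) fun x hx => ?_
    rw [interior_Icc] at hx
    rw [(hd x).deriv]
    have := hlb x ⟨by linarith [hx.1, hx.2], hx.2⟩
    rw [abs_of_pos hx.1, Nat.add_sub_cancel] at this
    linarith
  have hsame : ∀ a b : ℝ, 0 ≤ b → b ≤ a → a ≤ r →
      2 * c * ((a - b) / 2) ^ (q + 1) ≤ ρ a - ρ b := by
    intro a b hb hba har
    have h1 := hmono ⟨hb, hba.trans har⟩ ⟨hb.trans hba, har⟩ hba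
    have h2 := pow_add_pow_le hb (sub_nonneg.2 hba) q.add_one_ne_zero
    rw [add_sub_cancel] at h2
    have h3 : 2 * ((a - b) / 2) ^ (q + 1) ≤ (a - b) ^ (q + 1) := by
      rw [div_pow, pow_succ 2]
      have : (0 : ℝ) ≤ (a - b) ^ (q + 1) := pow_nonneg (sub_nonneg.2 hba) _
      have h4 : (1 : ℝ) ≤ 2 ^ q := one_le_pow₀ (by norm_num)
      rw [← mul_div_assoc, div_le_iff₀ (by positivity)]
      nlinarith
    simp only at h1
    nlinarith
  rcases le_total 0 t with h0t | ht0
  · exact hsame s t h0t hts (le_of_abs_le hs)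
  rcases le_total 0 s with h0s | hs0
  · have key : ∀ a : ℝ, 0 ≤ a → a ≤ r → c * a ^ (q + 1) ≤ ρ a := by
      intro a ha har
      have h1 := hmono ⟨le_rfl, ha.trans har⟩ ⟨ha, har⟩ ha
      simp [hρ0] at h1
      linarith
    have h1 := key s h0s (le_of_abs_le hs)
    have h2 := key (-t) (by linarith) ((neg_le_abs t).trans ht)
    rw [hanti] at h2
    have h3 := add_pow_le h0s (neg_nonneg.2 ht0) (q + 1)
    rw [Nat.add_sub_cancel] at h3
    have h4 : 2 * ((s - t) / 2) ^ (q + 1) ≤ s ^ (q + 1) + (-t) ^ (q + 1) := by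
      rw [div_pow, pow_succ 2, ← mul_div_assoc, div_le_iff₀ (by positivity), sub_eq_add_neg]
      nlinarith
    nlinarith
  · have := hsame (-t) (-s) (by linarith) (by linarith) ((neg_le_abs t).trans ht)
    rw [hanti, hanti] at this
    convert this using 1 <;> ring

theorem one_add_half_mul_sq_sub_one_le_pow {y : ℝ} (hy : 0 ≤ y) {n : ℕ} (hn : 2 ≤ n) :
    1 + (n / 2 : ℝ) * (y ^ 2 - 1) ≤ y ^ n := by
  have hn' : (1 : ℝ) ≤ n / 2 := by
    have : (2 : ℝ) ≤ n := by exact_mod_cast hn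
    linarith
  have h := one_add_mul_self_le_rpow_one_add (s := y ^ 2 - 1) (by nlinarith [sq_nonneg y]) hn'
  have e : (y ^ 2) ^ (n / 2 : ℝ) = y ^ n := by
    rw [← Real.rpow_natCast y 2, ← Real.rpow_mul hy, ← Real.rpow_natCast]
    congr 1
    push_cast
    ring
  rwa [add_sub_cancel, e] at h

theorem integral_comp_linearIsometryEquiv {E : Type*} [NormedAddCommGroup E]
    [InnerProductSpace ℝ E] [MeasurableSpace E] [BorelSpace E] {μ : Measure E}
    (hrot : ∀ T : E ≃ₗᵢ[ℝ] E, Measure.map (⇑T) μ = μ) (T : E ≃ₗᵢ[ℝ] E) (F : E → ℝ) :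
    ∫ x, F (T x) ∂μ = ∫ x, F x ∂μ := by
  conv_rhs => rw [← hrot T]
  exact (T.toHomeomorph.measurableEmbedding.integral_map F).symm

section Sphere

variable {E : Type*} [NormedAddCommGroup E] [InnerProductSpace ℝ E] [FiniteDimensional ℝ E]
  [MeasurableSpace E] [BorelSpace E] {μ : Measure E} [IsProbabilityMeasure μ]

theorem integrable_of_continuous_of_sphere (hsph : ∀ᵐ x ∂μ, ‖x‖ = 1) {F : E → ℝ}
    (hF : Continuous F) : Integrable F μ := by
  obtain ⟨C, hC⟩ := (isCompact_sphere (0 : E) 1).exists_bound_of_continuousOn hF.continuousOn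
  refine Integrable.of_bound hF.aestronglyMeasurable C ?_
  filter_upwards [hsph] with x hx
  exact hC x (by simpa using hx)

/-- The second moment of a coordinate of a rotation-invariant unit vector. -/
theorem finrank_mul_integral_inner_sq (hsph : ∀ᵐ x ∂μ, ‖x‖ = 1)
    (hrot : ∀ T : E ≃ₗᵢ[ℝ] E, Measure.map (⇑T) μ = μ) {e : E} (he : ‖e‖ = 1) :
    (Module.finrank ℝ E : ℝ) * ∫ x, ⟪x, e⟫ ^ 2 ∂μ = 1 := by
  have hsame : ∀ i, ∫ x, ⟪x, stdOrthonormalBasis ℝ E i⟫ ^ 2 ∂μ = ∫ x, ⟪x, e⟫ ^ 2 ∂μ := by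
    intro i
    set b := stdOrthonormalBasis ℝ E i
    have hb : ‖b‖ = ‖e‖ := by rw [he]; exact (stdOrthonormalBasis ℝ E).orthonormal.1 i
    rw [← integral_comp_linearIsometryEquiv hrot (ℝ ∙ (b - e))ᗮ.reflection (fun x => ⟪x, e⟫ ^ 2)]
    refine integral_congr_ae (.of_forall fun x => ?_)
    simp only
    rw [← LinearIsometryEquiv.inner_map_map (ℝ ∙ (b - e))ᗮ.reflection x b,
      Submodule.reflection_sub hb]
  have hsum : ∑ i, ∫ x, ⟪x, stdOrthonormalBasis ℝ E i⟫ ^ 2 ∂μ = 1 := by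
    rw [← integral_finsetSum _ fun i _ => integrable_of_continuous_of_sphere hsph (by fun_prop)]
    have : ∫ x, (1 : ℝ) ∂μ = 1 := by simp
    rw [← this]
    refine integral_congr_ae ?_
    filter_upwards [hsph] with x hx
    rw [OrthonormalBasis.sum_sq_inner_left, hx, one_pow]
  simpa [hsame] using hsum

/-- Lower bound for the absolute moments of a linear functional of a rotation-invariant unit
vector. -/
theorem le_integral_abs_inner_pow (hsph : ∀ᵐ x ∂μ, ‖x‖ = 1)
    (hrot : ∀ T : E ≃ₗᵢ[ℝ] E, Measure.map (⇑T) μ = μ) {v : E} (hv : v ≠ 0) {n : ℕ} (hn : 2 ≤ n) :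
    (‖v‖ / √(Module.finrank ℝ E)) ^ n ≤ ∫ x, |⟪x, v⟫| ^ n ∂μ := by
  have : Nontrivial E := ⟨v, 0, hv⟩
  set m : ℝ := ((Module.finrank ℝ E : ℕ) : ℝ)
  have hm : 0 < m := Nat.cast_pos.2 Module.finrank_pos
  have hv' : 0 < ‖v‖ := norm_pos_iff.2 hv
  set e := ‖v‖⁻¹ • v
  have he : ‖e‖ = 1 := norm_smul_inv_norm (𝕜 := ℝ) hv
  have hsq := finrank_mul_integral_inner_sq hsph hrot he
  have hint := integrable_of_continuous_of_sphere (μ := μ) hsph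
    (F := fun x => m * ⟪x, e⟫ ^ 2) (by fun_prop)
  have h1 : 1 ≤ ∫ x, (√m * |⟪x, e⟫|) ^ n ∂μ := by
    calc (1 : ℝ) = ∫ x, (1 + (n / 2 : ℝ) * (m * ⟪x, e⟫ ^ 2 - 1)) ∂μ := by
          rw [integral_add (integrable_const _) (integrable_of_continuous_of_sphere hsph (by fun_prop)),
            integral_const_mul, integral_sub hint (integrable_const _), integral_const_mul, hsq]
          simp
      _ ≤ _ := by
          refine integral_mono
            (integrable_of_continuous_of_sphere hsph (by fun_prop))
            (integrable_of_continuous_of_sphere hsph (by fun_prop)) fun x => ?_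
          have := one_add_half_mul_sq_sub_one_le_pow (y := √m * |⟪x, e⟫|) (by positivity) hn
          rwa [mul_pow, Real.sq_sqrt hm.le, sq_abs] at this
  have h2 : ∀ x, |⟪x, v⟫| ^ n = (‖v‖ / √m) ^ n * (√m * |⟪x, e⟫|) ^ n := by
    intro x
    rw [← mul_pow, real_inner_smul_right, abs_mul, abs_of_pos (inv_pos.2 hv')]
    have := Real.sqrt_pos.2 hm
    congr 1
    field_simp
  simp_rw [h2]
  rw [integral_const_mul]
  exact le_mul_of_one_le_right (by positivity) h1

end Sphere

/-- The symmetric difference of `f` at `w` with step `γ` in the direction `u`. -/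
def symmDifference {E : Type*} [NormedAddCommGroup E] [NormedSpace ℝ E] (f : E → ℝ) (w : E)
    (γ : ℝ) (u : E) : ℝ :=
  f (w + γ • u) - f (w - γ • u)

section Descent

variable {E : Type*} [NormedAddCommGroup E] [InnerProductSpace ℝ E]

/-- Near `w` the gradient keeps a large inner product with the direction `w - z` pointing away
from a much better point `z`. -/
theorem le_inner_gradient_of_gap {f : E → ℝ} {g : E → E} {β γ ε D : ℝ} (hβ : 0 < β)
    (hconv : ∀ x y, ⟪g x, y - x⟫ ≤ f y - f x)
    (hsmooth : ∀ x y, f y ≤ f x + ⟪g x, y - x⟫ + β / 2 * ‖y - x‖ ^ 2)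
    {w z : E} (hgap : ε < f w - f z) (hdist : ‖w - z‖ ≤ D) (hγ : 0 ≤ γ)
    (hγε : β * γ * D ≤ ε / 20) {x : E} (hx : ‖x - w‖ ≤ γ) :
    19 / 20 * ε ≤ ⟪g x, w - z⟫ := by
  have h1 := hconv w z
  rw [← neg_sub w z, inner_neg_right] at h1
  have h2 := norm_gradient_sub_le hβ hconv hsmooth x w
  have h3 := neg_le_of_abs_le (abs_real_inner_le_norm (g x - g w) (w - z))
  have h4 : ‖g x - g w‖ * ‖w - z‖ ≤ β * γ * D := by
    have : ‖g x - g w‖ ≤ β * γ := h2.trans (by gcongr)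
    gcongr
  rw [inner_sub_left] at h3
  linarith

theorem le_symmDifference_sub_reflection {f : E → ℝ} {g : E → E} {β γ ε D : ℝ} (hβ : 0 < β)
    (hconv : ∀ x y, ⟪g x, y - x⟫ ≤ f y - f x)
    (hsmooth : ∀ x y, f y ≤ f x + ⟪g x, y - x⟫ + β / 2 * ‖y - x‖ ^ 2)
    {w z : E} (hgap : ε < f w - f z) (hdist : ‖w - z‖ ≤ D) (hγ : 0 ≤ γ)
    (hγε : β * γ * D ≤ ε / 20) {u : E} (hu : ‖u‖ = 1) (ha : 0 ≤ ⟪u, w - z⟫) :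
    2 * (19 / 10 * γ * ε / ‖w - z‖ ^ 2 * ⟪u, w - z⟫) ≤
      symmDifference f w γ u - symmDifference f w γ ((ℝ ∙ (w - z))ᗮ.reflection u) := by
  set R := (ℝ ∙ (w - z))ᗮ.reflection
  have hR : R u = u - (2 * ⟪u, w - z⟫ / ‖w - z‖ ^ 2) • (w - z) :=
    reflection_orthogonal_singleton_apply _ _
  set s := 2 * ⟪u, w - z⟫ / ‖w - z‖ ^ 2 with hs
  have hs0 : 0 ≤ γ * s := by positivity
  have hRu : ‖R u‖ = 1 := by rw [LinearIsometryEquiv.norm_map, hu]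
  have h1 := hconv (w + γ • R u) (w + γ • u)
  have h2 := hconv (w - γ • u) (w - γ • R u)
  have e1 : w + γ • u - (w + γ • R u) = (γ * s) • (w - z) := by
    rw [hR, mul_smul]; module
  have e2 : w - γ • R u - (w - γ • u) = (γ * s) • (w - z) := by
    rw [hR, mul_smul]; module
  rw [e1, real_inner_smul_right] at h1
  rw [e2, real_inner_smul_right] at h2
  have h3 := le_inner_gradient_of_gap hβ hconv hsmooth hgap hdist hγ hγε
    (x := w + γ • R u) (by simp [norm_smul, hRu, abs_of_nonneg hγ])
  have h4 := le_inner_gradient_of_gap hβ hconv hsmooth hgap hdist hγ hγε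
    (x := w - γ • u) (by simp [norm_smul, hu, abs_of_nonneg hγ])
  have h5 := mul_le_mul_of_nonneg_left h3 hs0
  have h6 := mul_le_mul_of_nonneg_left h4 hs0
  have e3 : 2 * (19 / 10 * γ * ε / ‖w - z‖ ^ 2 * ⟪u, w - z⟫) = 2 * (γ * s * (19 / 20 * ε)) := by
    rw [hs]; ring
  rw [e3, symmDifference, symmDifference]
  linarith

theorem abs_symmDifference_le {f : E → ℝ} {L γ : ℝ}
    (hLip : ∀ x y, |f x - f y| ≤ L * ‖x - y‖) (hγ : 0 ≤ γ) (w : E) {u : E} (hu : ‖u‖ = 1) :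
    |symmDifference f w γ u| ≤ 2 * L * γ := by
  refine (hLip _ _).trans_eq ?_
  have : w + γ • u - (w - γ • u) = (2 * γ) • u := by module
  rw [this, norm_smul, hu, Real.norm_of_nonneg (by positivity)]
  ring

/-- Reflecting `u` across the hyperplane orthogonal to `w - z` moves the transferred symmetric
difference in the direction given by the sign of `⟪u, w - z⟫`. -/
theorem le_transfer_sub_reflection_mul_inner {f : E → ℝ} {g : E → E} {β γ ε D L r c : ℝ}
    {ρ ρd : ℝ → ℝ} {p : ℕ} (hp : 1 ≤ p) (hc : 0 < c)
    (hρdiff : ∀ x, HasDerivAt ρ (ρd x) x) (hρanti : ∀ x, ρ (-x) = -ρ x) (hρ0 : ρ 0 = 0)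
    (hρlb : ∀ x ∈ Set.Ioo (-r) r, c * p * |x| ^ (p - 1) ≤ ρd x) (hβ : 0 < β)
    (hconv : ∀ x y, ⟪g x, y - x⟫ ≤ f y - f x)
    (hsmooth : ∀ x y, f y ≤ f x + ⟪g x, y - x⟫ + β / 2 * ‖y - x‖ ^ 2)
    (hLip : ∀ x y, |f x - f y| ≤ L * ‖x - y‖)
    {w z : E} (hε : 0 ≤ ε) (hgap : ε < f w - f z) (hdist : ‖w - z‖ ≤ D) (hγ : 0 ≤ γ)
    (hγε : β * γ * D ≤ ε / 20) (hγr : 2 * L * γ ≤ r) {u : E} (hu : ‖u‖ = 1) :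
    2 * (c * (19 / 10 * γ * ε / ‖w - z‖ ^ 2) ^ p * |⟪u, w - z⟫| ^ (p + 1)) ≤
      (ρ (symmDifference f w γ u) -
        ρ (symmDifference f w γ ((ℝ ∙ (w - z))ᗮ.reflection u))) * ⟪u, w - z⟫ := by
  set R := (ℝ ∙ (w - z))ᗮ.reflection
  set k := 19 / 10 * γ * ε / ‖w - z‖ ^ 2 with hk
  have hk0 : 0 ≤ k := by positivity
  have key : ∀ y : E, ‖y‖ = 1 → 0 ≤ ⟪y, w - z⟫ →
      2 * (c * k ^ p * |⟪y, w - z⟫| ^ (p + 1)) ≤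
        (ρ (symmDifference f w γ y) - ρ (symmDifference f w γ (R y))) * ⟪y, w - z⟫ := by
    intro y hy ha
    have hRy : ‖R y‖ = 1 := by rw [LinearIsometryEquiv.norm_map, hy]
    have h1 := le_symmDifference_sub_reflection hβ hconv hsmooth hgap hdist hγ hγε hy ha
    have hka : 0 ≤ k * ⟪y, w - z⟫ := by positivity
    have h2 := odd_increment_lower_bound hp hc hρdiff hρanti hρ0 hρlb
      (s := symmDifference f w γ y) (t := symmDifference f w γ (R y)) (by linarith)
      ((abs_symmDifference_le hLip hγ w hy).trans hγr)
      ((abs_symmDifference_le hLip hγ w hRy).trans hγr)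
    have h3 : 2 * c * (k * ⟪y, w - z⟫) ^ p ≤
        ρ (symmDifference f w γ y) - ρ (symmDifference f w γ (R y)) := by
      refine le_trans ?_ h2
      gcongr
      linarith
    rw [abs_of_nonneg ha, pow_succ]
    calc _ = 2 * c * (k * ⟪y, w - z⟫) ^ p * ⟪y, w - z⟫ := by rw [mul_pow]; ring
      _ ≤ _ := mul_le_mul_of_nonneg_right h3 ha
  have hneg : ⟪R u, w - z⟫ = -⟪u, w - z⟫ := by
    have h := LinearIsometryEquiv.inner_map_map R u (w - z)
    rw [Submodule.reflection_orthogonalComplement_singleton_eq_neg, inner_neg_right] at h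
    linarith
  rcases le_total 0 ⟪u, w - z⟫ with ha | ha
  · exact key u hu ha
  · have h := key (R u) (by rw [LinearIsometryEquiv.norm_map, hu]) (by linarith)
    rw [hneg, Submodule.reflection_reflection, abs_neg] at h
    linarith

/-- The transferred symmetric difference along a uniform direction `u` correlates with
`⟪u, w - z⟫`. -/
theorem le_integral_transfer_mul_inner [FiniteDimensional ℝ E] [MeasurableSpace E] [BorelSpace E]
    {μ : Measure E} [IsProbabilityMeasure μ] (hsph : ∀ᵐ x ∂μ, ‖x‖ = 1)
    (hrot : ∀ T : E ≃ₗᵢ[ℝ] E, Measure.map (⇑T) μ = μ)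
    {f : E → ℝ} {g : E → E} {β γ ε D L r c : ℝ}
    {ρ ρd : ℝ → ℝ} {p : ℕ} (hp : 1 ≤ p) (hc : 0 < c)
    (hρdiff : ∀ x, HasDerivAt ρ (ρd x) x) (hρanti : ∀ x, ρ (-x) = -ρ x) (hρ0 : ρ 0 = 0)
    (hρlb : ∀ x ∈ Set.Ioo (-r) r, c * p * |x| ^ (p - 1) ≤ ρd x) (hβ : 0 < β) (hf : Continuous f)
    (hconv : ∀ x y, ⟪g x, y - x⟫ ≤ f y - f x)
    (hsmooth : ∀ x y, f y ≤ f x + ⟪g x, y - x⟫ + β / 2 * ‖y - x‖ ^ 2)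
    (hLip : ∀ x y, |f x - f y| ≤ L * ‖x - y‖)
    {w z : E} (hε : 0 ≤ ε) (hgap : ε < f w - f z) (hdist : ‖w - z‖ ≤ D) (hγ : 0 ≤ γ)
    (hγε : β * γ * D ≤ ε / 20) (hγr : 2 * L * γ ≤ r) :
    c * (19 / 10 * γ * ε / ‖w - z‖ ^ 2) ^ p * (‖w - z‖ / √(Module.finrank ℝ E)) ^ (p + 1) ≤
      ∫ u, ρ (symmDifference f w γ u) * ⟪u, w - z⟫ ∂μ := by
  have hv : w - z ≠ 0 := by
    intro h
    rw [sub_eq_zero.1 h, sub_self] at hgap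
    linarith
  have hρ : Continuous ρ := continuous_iff_continuousAt.2 fun x => (hρdiff x).continuousAt
  have hΔ : Continuous (symmDifference f w γ) := by unfold symmDifference; fun_prop
  set R := (ℝ ∙ (w - z))ᗮ.reflection
  set k := 19 / 10 * γ * ε / ‖w - z‖ ^ 2
  have hk0 : 0 ≤ k := by positivity
  have hRint : ∫ u, ρ (symmDifference f w γ (R u)) * ⟪u, w - z⟫ ∂μ =
      -∫ u, ρ (symmDifference f w γ u) * ⟪u, w - z⟫ ∂μ := by
    rw [← integral_comp_linearIsometryEquiv hrot R
      (fun u => ρ (symmDifference f w γ u) * ⟪u, w - z⟫), ← integral_neg]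
    refine integral_congr_ae (.of_forall fun u => ?_)
    have h := LinearIsometryEquiv.inner_map_map R u (w - z)
    rw [Submodule.reflection_orthogonalComplement_singleton_eq_neg, inner_neg_right] at h
    simp only [← h]
    ring
  have hmain : ∫ u, 2 * (c * k ^ p * |⟪u, w - z⟫| ^ (p + 1)) ∂μ ≤
      ∫ u, (ρ (symmDifference f w γ u) * ⟪u, w - z⟫ -
        ρ (symmDifference f w γ (R u)) * ⟪u, w - z⟫) ∂μ := by
    refine integral_mono_ae (integrable_of_continuous_of_sphere hsph (by fun_prop))
      (integrable_of_continuous_of_sphere hsph (by fun_prop)) ?_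
    filter_upwards [hsph] with u hu
    rw [← sub_mul]
    exact le_transfer_sub_reflection_mul_inner hp hc hρdiff hρanti hρ0 hρlb hβ hconv hsmooth hLip
      hε hgap hdist hγ hγε hγr hu
  rw [integral_sub (integrable_of_continuous_of_sphere hsph (by fun_prop))
    (integrable_of_continuous_of_sphere hsph (by fun_prop)), hRint, integral_const_mul,
    integral_const_mul] at hmain
  have hmom := mul_le_mul_of_nonneg_left
    (le_integral_abs_inner_pow hsph hrot hv (n := p + 1) (by omega))
    (show 0 ≤ c * k ^ p by positivity)
  linarith

end Descent

/-- The random sign may be replaced by its conditional mean given `u` when paired with a bounded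
function of `u`. -/
theorem integral_mul_comp_eq_of_condExp_eq {Ω X : Type*} [MeasurableSpace Ω]
    [mX : MeasurableSpace X]
    {P : Measure Ω} [IsProbabilityMeasure P] {u : Ω → X} (hu : Measurable u) {o q : Ω → ℝ}
    (ho : Integrable o P) (hcond : P[o | MeasurableSpace.comap u mX] =ᵐ[P] q)
    {h : X → ℝ} (hh : Measurable h) {C : ℝ} (hC : ∀ᵐ ω ∂P, |h (u ω)| ≤ C) :
    ∫ ω, h (u ω) * o ω ∂P = ∫ ω, h (u ω) * q ω ∂P := by
  have hm : MeasurableSpace.comap u mX ≤ _ := hu.comap_le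
  have hmeas : StronglyMeasurable[MeasurableSpace.comap u mX] fun ω => h (u ω) :=
    (hh.comp (comap_measurable u)).stronglyMeasurable
  have h1 := condExp_stronglyMeasurable_mul_of_bound hm hmeas ho C hC
  rw [← integral_condExp hm]
  refine integral_congr_ae ?_
  filter_upwards [h1, hcond] with ω h1 h2
  exact h1.trans (by rw [Pi.mul_apply, h2])

/-- The step size is at most the correlation guaranteed by `le_integral_transfer_mul_inner`; here
`S` is the square root of the dimension and `n` the distance to the minimizer. -/
theorem stepSize_le {β c ε D S n γ : ℝ} {p : ℕ} (hp : 1 ≤ p) (hβ : 0 < β) (hc : 0 < c)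
    (hε : 0 < ε) (hS : 0 < S) (hn : 0 < n) (hnD : n ≤ D)
    (hγ : γ = (1 / 20) * ε / (β * S * D)) :
    (p : ℝ) * c * (1 / 20 : ℝ) ^ (2 * p - 1) * ε ^ (2 * p) /
      (S ^ (2 * p + 1) * β ^ p * D ^ (2 * p - 1)) ≤
      c * (19 / 10 * γ * ε / n ^ 2) ^ p * (n / S) ^ (p + 1) := by
  obtain ⟨q, rfl⟩ : ∃ q, p = q + 1 := ⟨p - 1, by omega⟩
  have hD : 0 < D := hn.trans_le hnD
  have hγ0 : 0 < γ := by rw [hγ]; positivity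
  have hexp : 2 * (q + 1) - 1 = 2 * q + 1 := by omega
  have hlhs : ((q + 1 : ℕ) : ℝ) * c * (1 / 20 : ℝ) ^ (2 * (q + 1) - 1) * ε ^ (2 * (q + 1)) /
      (S ^ (2 * (q + 1) + 1) * β ^ (q + 1) * D ^ (2 * (q + 1) - 1)) =
      (((q + 1 : ℕ) : ℝ) * (1 / 20 : ℝ) ^ q) * (c * (γ * ε) ^ (q + 1) / (D ^ q * S ^ (q + 2))) := by
    rw [hexp, hγ]
    simp only [mul_pow, div_pow, one_pow]
    field_simp
    ring
  have hrhs : c * (19 / 10 * γ * ε / n ^ 2) ^ (q + 1) * (n / S) ^ (q + 1 + 1) =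
      (19 / 10 : ℝ) ^ (q + 1) * (c * (γ * ε) ^ (q + 1) / (n ^ q * S ^ (q + 2))) := by
    simp only [mul_pow, div_pow]
    field_simp
    ring
  have hconst : ((q + 1 : ℕ) : ℝ) * (1 / 20 : ℝ) ^ q ≤ (19 / 10 : ℝ) ^ (q + 1) := by
    have h1 : ((q + 1 : ℕ) : ℝ) ≤ 20 ^ q := by
      have h2 : q + 1 ≤ 2 ^ q := Nat.lt_two_pow_self
      have h3 : (2 : ℕ) ^ q ≤ 20 ^ q := Nat.pow_le_pow_left (by norm_num) q
      exact_mod_cast h2.trans h3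
    calc ((q + 1 : ℕ) : ℝ) * (1 / 20 : ℝ) ^ q ≤ 20 ^ q * (1 / 20 : ℝ) ^ q := by gcongr
      _ = 1 := by rw [← mul_pow]; norm_num
      _ ≤ _ := one_le_pow₀ (by norm_num)
  rw [hlhs, hrhs]
  gcongr

/-- Roundwise progress of Relative-Gradient-Descent: Under the general
transfer function assumptions with minimal degree `p ≥ 1`, if `w_t ∈ 𝒟` satisfies
`f(w_t) − f(w*) > ε`, `c̃ = 1/20`, `γ = c̃ε/(β√d·D)` (with `2Lγ ≤ r`),
`η = p·c_ρ·c̃^{2p−1}·ε^{2p}/(d^{(2p+1)/2}·β^p·D^{2p−1})`, and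
`w_{t+1} = Π_𝒟(w_t − η·o·u)`, then
`E[‖w_{t+1} − w*‖²] ≤ ‖w_t − w*‖² − p²·(c̃^{2p−1}·c_ρ)²·ε^{4p}/(d^{2p+1}·β^{2p}·D^{4p−2})`. -/
theorem stmt11 (d p : ℕ) (hd : 0 < d) (hp : 1 ≤ p)
    (β L r cρ ε D : ℝ)
    (hβ : 0 < β) (hL : 0 < L) (hr : 0 < r) (hcρ : 0 < cρ) (hε : 0 < ε) (hD : 0 < D)
    (𝒟 : Set (EuclideanSpace ℝ (Fin d))) (hconv : Convex ℝ 𝒟) (hclosed : IsClosed 𝒟)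
    (hbdd : Bornology.IsBounded 𝒟) (hdiam : Metric.diam 𝒟 = D)
    (f : EuclideanSpace ℝ (Fin d) → ℝ)
    (gradf : EuclideanSpace ℝ (Fin d) → EuclideanSpace ℝ (Fin d))
    (hdiff : ∀ x, HasGradientAt f (gradf x) x)
    (hconvf : ∀ x y, ⟪gradf x, y - x⟫ ≤ f y - f x)
    (hLip : ∀ x y, |f x - f y| ≤ L * ‖x - y‖)
    (hsmooth : ∀ x y, f y ≤ f x + ⟪gradf x, y - x⟫ + β / 2 * ‖y - x‖ ^ 2)
    (wstar : EuclideanSpace ℝ (Fin d)) (hws : wstar ∈ 𝒟)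
    (hmin : ∀ v ∈ 𝒟, f wstar ≤ f v)
    (ρ ρd : ℝ → ℝ)
    (hρrange : ∀ x, ρ x ∈ Set.Icc (-1 : ℝ) 1)
    (hρdiff : ∀ x, HasDerivAt ρ (ρd x) x)
    (hρanti : ∀ x, ρ (-x) = -ρ x)
    (hρ0 : ρ 0 = 0)
    (hρsign : ∀ x : ℝ, x ≠ 0 → Real.sign (ρ x) = Real.sign x)
    (hρlb : ∀ x ∈ Set.Ioo (-r) r, cρ * p * |x| ^ (p - 1) ≤ ρd x)
    (γ η : ℝ) (hγdef : γ = (1 / 20) * ε / (β * Real.sqrt d * D)) (hγr : 2 * L * γ ≤ r)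
    (hηdef : η = (p : ℝ) * cρ * (1 / 20 : ℝ) ^ (2 * p - 1) * ε ^ (2 * p) /
      ((d : ℝ) ^ ((2 * (p : ℝ) + 1) / 2) * β ^ p * D ^ (2 * p - 1)))
    (proj : EuclideanSpace ℝ (Fin d) → EuclideanSpace ℝ (Fin d))
    (hprojmem : ∀ z, proj z ∈ 𝒟)
    (hproj : ∀ z, ∀ y ∈ 𝒟, ‖proj z - z‖ ≤ ‖y - z‖)
    (wt : EuclideanSpace ℝ (Fin d)) (hwt : wt ∈ 𝒟) (hgap : ε < f wt - f wstar)
    (μ : Measure (EuclideanSpace ℝ (Fin d))) [IsProbabilityMeasure μ]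
    (hsph : ∀ᵐ x ∂μ, ‖x‖ = 1)
    (hrot : ∀ T : EuclideanSpace ℝ (Fin d) ≃ₗᵢ[ℝ] EuclideanSpace ℝ (Fin d),
      Measure.map (⇑T) μ = μ)
    (Ω : Type) [MeasurableSpace Ω] (P : Measure Ω) [IsProbabilityMeasure P]
    (u : Ω → EuclideanSpace ℝ (Fin d)) (hu : Measurable u)
    (hulaw : Measure.map u P = μ)
    (o : Ω → ℝ) (ho : Measurable o) (hosign : ∀ ω, o ω = 1 ∨ o ω = -1)
    (hcond : P[o | MeasurableSpace.comap u inferInstance] =ᵐ[P]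
      fun ω => ρ (f (wt + γ • u ω) - f (wt - γ • u ω))) :
    ∫ ω, ‖proj (wt - (η * o ω) • u ω) - wstar‖ ^ 2 ∂P ≤
      ‖wt - wstar‖ ^ 2 -
        (p : ℝ) ^ 2 * ((1 / 20 : ℝ) ^ (2 * p - 1) * cρ) ^ 2 * ε ^ (4 * p) /
          ((d : ℝ) ^ (2 * p + 1) * β ^ (2 * p) * D ^ (4 * p - 2)) := by
  have hS : 0 < √(d : ℝ) := Real.sqrt_pos.2 (Nat.cast_pos.2 hd)
  have hd1 : 1 ≤ √(d : ℝ) := Real.one_le_sqrt.2 (by exact_mod_cast hd)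
  have hγ : 0 < γ := by rw [hγdef]; positivity
  have hdist : ‖wt - wstar‖ ≤ D := by
    rw [← hdiam, ← dist_eq_norm]
    exact Metric.dist_le_diam_of_mem hbdd hwt hws
  have hv : 0 < ‖wt - wstar‖ := by
    rw [norm_pos_iff, sub_ne_zero]
    rintro rfl
    linarith
  have hγε : β * γ * D ≤ ε / 20 := by
    have : β * γ * D = ε / 20 / √d := by rw [hγdef]; field_simp
    rw [this]
    exact div_le_self (by positivity) hd1
  have hdpow : (d : ℝ) ^ ((2 * (p : ℝ) + 1) / 2) = √d ^ (2 * p + 1) := by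
    rw [Real.sqrt_eq_rpow, ← Real.rpow_natCast, ← Real.rpow_mul (Nat.cast_nonneg d)]
    congr 1
    push_cast
    ring
  rw [hdpow] at hηdef
  have hη : 0 ≤ η := by rw [hηdef]; positivity
  have hηsq : (p : ℝ) ^ 2 * ((1 / 20 : ℝ) ^ (2 * p - 1) * cρ) ^ 2 * ε ^ (4 * p) /
      ((d : ℝ) ^ (2 * p + 1) * β ^ (2 * p) * D ^ (4 * p - 2)) = η ^ 2 := by
    have hexp : 4 * p - 2 = (2 * p - 1) * 2 := by omega
    have hdsq : (d : ℝ) = √d ^ 2 := (Real.sq_sqrt (Nat.cast_nonneg d)).symm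
    rw [hηdef, hexp]
    conv_lhs => rw [hdsq]
    simp only [div_pow, mul_pow, ← pow_mul]
    ring
  have hcont : Continuous f := continuous_iff_continuousAt.2 fun x => (hdiff x).continuousAt
  have hΔ : Continuous (symmDifference f wt γ) := by unfold symmDifference; fun_prop
  have hρ : Continuous ρ := continuous_iff_continuousAt.2 fun x => (hρdiff x).continuousAt
  have hunorm : ∀ᵐ ω ∂P, ‖u ω‖ = 1 := by
    rw [← hulaw] at hsph
    exact ae_of_ae_map hu.aemeasurable hsph
  have hobound : ∀ ω, |o ω| = 1 := fun ω => by rcases hosign ω with h | h <;> simp [h]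
  have hoint : Integrable o P :=
    Integrable.of_bound ho.aestronglyMeasurable 1 (.of_forall fun ω => (hobound ω).le)
  have hinner : ∀ᵐ ω ∂P, |⟪u ω, wt - wstar⟫| ≤ ‖wt - wstar‖ := by
    filter_upwards [hunorm] with ω hω
    simpa [hω] using abs_real_inner_le_norm (u ω) (wt - wstar)
  have hcorr : η ≤ ∫ ω, ⟪u ω, wt - wstar⟫ * o ω ∂P := by
    rw [integral_mul_comp_eq_of_condExp_eq hu hoint hcond (h := fun x => ⟪x, wt - wstar⟫)
      (by fun_prop) hinner]
    have hlaw : ∫ ω, ⟪u ω, wt - wstar⟫ * ρ (f (wt + γ • u ω) - f (wt - γ • u ω)) ∂P =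
        ∫ x, ρ (symmDifference f wt γ x) * ⟪x, wt - wstar⟫ ∂μ := by
      rw [← hulaw, integral_map hu.aemeasurable (by fun_prop)]
      simp only [symmDifference, mul_comm]
    rw [hlaw]
    refine le_trans ?_ (le_integral_transfer_mul_inner hsph hrot hp hcρ hρdiff hρanti hρ0 hρlb hβ
      hcont hconvf hsmooth hLip hε.le hgap hdist hγ.le hγε hγr)
    rw [finrank_euclideanSpace_fin, hηdef]
    exact stepSize_le hp hβ hcρ hε hS hv hdist hγdef
  have hint : Integrable (fun ω => ⟪u ω, wt - wstar⟫ * o ω) P := by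
    refine Integrable.of_bound (by fun_prop) ‖wt - wstar‖ ?_
    filter_upwards [hinner] with ω hω
    simpa [abs_mul, hobound ω] using hω
  have hstep : ∀ᵐ ω ∂P, ‖proj (wt - (η * o ω) • u ω) - wstar‖ ^ 2 ≤
      ‖wt - wstar‖ ^ 2 - 2 * η * (⟪u ω, wt - wstar⟫ * o ω) + η ^ 2 := by
    filter_upwards [hunorm] with ω hω
    have h1 := norm_nearest_sub_le hconv (hprojmem (wt - (η * o ω) • u ω)) (hproj _) hws
    have h2 : wt - (η * o ω) • u ω - wstar = (wt - wstar) - (η * o ω) • u ω := by abel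
    have h3 : ‖(η * o ω) • u ω‖ = η := by
      rw [norm_smul, hω, Real.norm_eq_abs, abs_mul, hobound, abs_of_nonneg hη, mul_one, mul_one]
    calc _ ≤ ‖wt - (η * o ω) • u ω - wstar‖ ^ 2 := by gcongr
      _ = _ := by
        rw [h2, norm_sub_sq_real, h3, real_inner_smul_right, real_inner_comm]
        ring
  rw [hηsq]
  have hint2 : Integrable (fun ω => ‖wt - wstar‖ ^ 2 - 2 * η * (⟪u ω, wt - wstar⟫ * o ω)) P :=
    (integrable_const _).sub (hint.const_mul _)
  calc _ ≤ ∫ ω, (‖wt - wstar‖ ^ 2 - 2 * η * (⟪u ω, wt - wstar⟫ * o ω) + η ^ 2) ∂P :=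
        integral_mono_of_nonneg (.of_forall fun ω => by positivity)
          (hint2.add (integrable_const _)) hstep
    _ = ‖wt - wstar‖ ^ 2 - 2 * η * ∫ ω, ⟪u ω, wt - wstar⟫ * o ω ∂P + η ^ 2 := by
        rw [integral_add hint2 (integrable_const _),
          integral_sub (integrable_const _) (hint.const_mul _), integral_const_mul]
        simp
    _ ≤ _ := by nlinarith
end
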